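/- arXiv:1710.05352 — 3 statements merged into one kernel-verified Lean document; each statement's English description precedes it below -/
import Mathlib

section
/- Almost surely, for every t ∈ (0,1), the averages (1/N) ∑_{n=0}^{N−1} ξ_n e^{2πint} converge to 0 as N → ∞. (Equivalently, the set 𝔛₊ is almost surely L²-exact, hence almost surely a recurrent (Poincaré) set.) -/
open MeasureTheory Complex Filter Finset
open scoped ENNReal

noncomputable def fhat (f : AddCircle (1:ℝ) → ℝ) (k : ℤ) : ℂ :=
  fourierCoeff (fun t => (f t : ℂ)) k

/-- bounded measurable functions -/
def BM {Ω : Type*} [MeasurableSpace Ω] (g : Ω → ℝ) : Prop := Measurable g ∧ ∀ ω, |g ω| ≤ 1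

section
variable {Ω : Type*} [MeasurableSpace Ω]

lemma BM.mul {g h : Ω → ℝ} (hg : BM g) (hh : BM h) : BM (fun ω => g ω * h ω) :=
  ⟨hg.1.mul hh.1, fun ω => by rw [abs_mul]; exact mul_le_one₀ (hg.2 ω) (abs_nonneg _) (hh.2 ω)⟩

lemma BM.integrable {g : Ω → ℝ} (hg : BM g) (P : Measure Ω) [IsProbabilityMeasure P] :
    Integrable g P :=
  Integrable.of_bound hg.1.aestronglyMeasurable 1 (ae_of_all _ (fun ω => hg.2 ω))

lemma step (P : Measure Ω) [IsProbabilityMeasure P] (σ : ℝ) {p x g : Ω → ℝ}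
    (hp : BM p) (hx : BM x) (hg : BM g) :
    ∫ ω, p ω * ((x ω - σ) * g ω) ∂P = ∫ ω, (p ω * x ω) * g ω ∂P - σ * ∫ ω, p ω * g ω ∂P := by
  rw [← integral_const_mul, ← integral_sub]
  · congr 1; ext ω; ring
  · exact ((hp.mul hx).mul hg).integrable P
  · exact ((hp.mul hg).integrable P).const_mul σ

lemma expand4 (P : Measure Ω) [IsProbabilityMeasure P] (σ : ℝ) {x y z w : Ω → ℝ}
    (hx : BM x) (hy : BM y) (hz : BM z) (hw : BM w)
    (hx' : BM (fun ω => x ω - σ)) (hy' : BM (fun ω => y ω - σ))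
    (hz' : BM (fun ω => z ω - σ)) (hw' : BM (fun ω => w ω - σ)) :
    ∫ ω, (x ω - σ) * (y ω - σ) * ((z ω - σ) * (w ω - σ)) ∂P =
     ∫ ω, x ω * y ω * z ω * w ω ∂P
     - σ * (∫ ω, y ω * z ω * w ω ∂P + ∫ ω, x ω * z ω * w ω ∂P + ∫ ω, x ω * y ω * w ω ∂P
        + ∫ ω, x ω * y ω * z ω ∂P)
     + σ^2 * (∫ ω, x ω * y ω ∂P + ∫ ω, x ω * z ω ∂P + ∫ ω, x ω * w ω ∂P
        + ∫ ω, y ω * z ω ∂P + ∫ ω, y ω * w ω ∂P + ∫ ω, z ω * w ω ∂P)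
     - σ^3 * (∫ ω, x ω ∂P + ∫ ω, y ω ∂P + ∫ ω, z ω ∂P + ∫ ω, w ω ∂P) + σ^4 := by
  have h1 : BM (fun _ : Ω => (1:ℝ)) := ⟨measurable_const, by simp⟩
  have e : ∀ p : Ω → ℝ, BM p → ∫ ω, p ω * (w ω - σ) ∂P
      = ∫ ω, p ω * w ω ∂P - σ * ∫ ω, p ω ∂P := by
    intro p hp
    have := step P σ hp hw h1
    simpa using this
  have e2 : ∀ p : Ω → ℝ, BM p → ∫ ω, p ω * ((z ω - σ) * (w ω - σ)) ∂P
      = ∫ ω, p ω * z ω * w ω ∂P - σ * ∫ ω, p ω * z ω ∂P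
        - σ * (∫ ω, p ω * w ω ∂P - σ * ∫ ω, p ω ∂P) := by
    intro p hp
    rw [step P σ hp hz hw', e _ (hp.mul hz), e _ hp]
  have e3 := step P σ h1 hx (hy'.mul (hz'.mul hw'))
  rw [step P σ (h1.mul hx) hy (hz'.mul hw'), step P σ h1 hy (hz'.mul hw'),
    e2 _ ((h1.mul hx).mul hy), e2 _ (h1.mul hx), e2 _ (h1.mul hy), e2 _ h1] at e3
  simp only [one_mul, mul_assoc] at e3 ⊢
  rw [e3]
  simp
  ring
end

lemma fhat_zero (f : AddCircle (1:ℝ) → ℝ) :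
    fhat f 0 = ((∫ t, f t ∂AddCircle.haarAddCircle : ℝ) : ℂ) := by
  simp [fhat, fourierCoeff, integral_complex_ofReal]

lemma fhat_neg (f : AddCircle (1:ℝ) → ℝ) (k : ℤ) :
    fhat f (-k) = (starRingEnd ℂ) (fhat f k) := by
  simp only [fhat, fourierCoeff, ← integral_conj]
  congr 1; ext t
  simp

lemma norm_fhat_le (f : AddCircle (1:ℝ) → ℝ) 
    (hf01 : ∀ t, f t ∈ Set.Icc (0:ℝ) 1) (k : ℤ) : ‖fhat f k‖ ≤ 1 := by
  unfold fhat fourierCoeff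
  refine (norm_integral_le_of_norm_le_const (C := 1) (ae_of_all _ fun t => ?_)).trans (by simp)
  have := hf01 t
  rw [norm_smul]; simp only [fourier_apply, Circle.norm_coe, one_mul]; simp [abs_of_nonneg this.1, this.2]

lemma fhat_summable (f : AddCircle (1:ℝ) → ℝ) (hf_meas : Measurable f)
    (hf01 : ∀ t, f t ∈ Set.Icc (0:ℝ) 1) : Summable fun k => ‖fhat f k‖^2 := by
  have hm : MemLp (fun t => (f t : ℂ)) 2 (AddCircle.haarAddCircle (T := 1)) := by
    refine MemLp.of_bound (by fun_prop) 1 (ae_of_all _ fun t => ?_)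
    have := hf01 t
    simp [abs_of_nonneg this.1, this.2]
  have := (hasSum_sq_fourierCoeff (hm.toLp)).summable
  convert this using 4 with k
  unfold fhat
  exact (fourierCoeff_congr_ae hm.coeFn_toLp).symm ▸ rfl

lemma det3' (a : Fin 3 → Fin 3 → ℂ) : Matrix.det (Matrix.of a) =
   a 0 0 * a 1 1 * a 2 2 - a 0 0 * a 1 2 * a 2 1 - a 0 1 * a 1 0 * a 2 2 + a 0 1 * a 1 2 * a 2 0
   + a 0 2 * a 1 0 * a 2 1 - a 0 2 * a 1 1 * a 2 0 := by
  rw [Matrix.det_fin_three]; simp 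

lemma det4 (a : Fin 4 → Fin 4 → ℂ) : Matrix.det (Matrix.of a) =
   a 0 0 * (a 1 1 * a 2 2 * a 3 3- a 1 1 * a 2 3 * a 3 2 - a 1 2 * a 2 1 * a 3 3
     + a 1 2 * a 2 3 * a 3 1 + a 1 3 * a 2 1 * a 3 2 - a 1 3 * a 2 2 * a 3 1)
   - a 0 1 * (a 1 0 * a 2 2 * a 3 3- a 1 0 * a 2 3 * a 3 2 - a 1 2 * a 2 0 * a 3 3
     + a 1 2 * a 2 3 * a 3 0 + a 1 3 * a 2 0 * a 3 2 - a 1 3 * a 2 2 * a 3 0)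
   + a 0 2 * (a 1 0 * a 2 1 * a 3 3- a 1 0 * a 2 3 * a 3 1 - a 1 1 * a 2 0 * a 3 3
     + a 1 1 * a 2 3 * a 3 0 + a 1 3 * a 2 0 * a 3 1 - a 1 3 * a 2 1 * a 3 0)
   - a 0 3 * (a 1 0 * a 2 1 * a 3 2- a 1 0 * a 2 2 * a 3 1 - a 1 1 * a 2 0 * a 3 2
     + a 1 1 * a 2 2 * a 3 0 + a 1 2 * a 2 0 * a 3 1 - a 1 2 * a 2 1 * a 3 0) := by
  rw [Matrix.det_succ_row_zero]
  simp only [Matrix.det_fin_three, Fin.sum_univ_four]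
  simp [Fin.succAbove, Matrix.submatrix]
  norm_num [Fin.lt_def, Fin.ext_iff]
  ring

lemma corr4 (f : AddCircle (1:ℝ) → ℝ)
    (σ : ℝ) (hσ : σ = ∫ t, f t ∂AddCircle.haarAddCircle)
    (hσ0 : 0 < σ) (hσ1 : σ < 1)
    {Ω : Type*} [MeasurableSpace Ω] (P : Measure Ω) [IsProbabilityMeasure P]
    (ξ : ℤ → Ω → ℝ) (hb : ∀ n, BM (ξ n)) (hb' : ∀ n, BM (fun ω => ξ n ω - σ))
    (hDPP : ∀ (k : ℕ) (n : Fin k → ℤ), Function.Injective n →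
      ((∫ ω, ∏ i, ξ (n i) ω ∂P : ℝ) : ℂ) =
        Matrix.det (Matrix.of fun i j => fhat f (n i - n j)))
    (i j k l : ℤ) (hij : i ≠ j) (hik : i ≠ k) (hil : i ≠ l) (hjk : j ≠ k) (hjl : j ≠ l)
    (hkl : k ≠ l) :
    ((∫ ω, (ξ i ω - σ) * (ξ j ω - σ) * ((ξ k ω - σ) * (ξ l ω - σ)) ∂P : ℝ) : ℂ) =
      fhat f (i-j) * fhat f (j-i) * (fhat f (k-l) * fhat f (l-k))
      + fhat f (i-k) * fhat f (k-i) * (fhat f (j-l) * fhat f (l-j))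
      + fhat f (i-l) * fhat f (l-i) * (fhat f (j-k) * fhat f (k-j))
      - fhat f (i-j) * fhat f (j-k) * (fhat f (k-l) * fhat f (l-i))
      - fhat f (j-i) * fhat f (k-j) * (fhat f (l-k) * fhat f (i-l))
      - fhat f (i-j) * fhat f (j-l) * (fhat f (l-k) * fhat f (k-i))
      - fhat f (j-i) * fhat f (l-j) * (fhat f (k-l) * fhat f (i-k))
      - fhat f (i-k) * fhat f (k-j) * (fhat f (j-l) * fhat f (l-i))
      - fhat f (k-i) * fhat f (j-k) * (fhat f (l-j) * fhat f (i-l)) := by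
  have K0 : fhat f 0 = (σ : ℂ) := by rw [fhat_zero, hσ]
  have E1 : ∀ a, ((∫ ω, ξ a ω ∂P : ℝ) : ℂ) = σ := by
    intro a
    have := hDPP 1 ![a] (fun x y _ => Subsingleton.elim _ _)
    simpa [K0] using this
  have E2 : ∀ a b, a ≠ b → ((∫ ω, ξ a ω * ξ b ω ∂P : ℝ) : ℂ)
      = σ^2 - fhat f (a-b) * fhat f (b-a) := by
    intro a b h
    have := hDPP 2 ![a,b] (by
      intro x y; fin_cases x <;> fin_cases y <;> simp [h, h.symm])
    rw [Matrix.det_fin_two] at this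
    simp only [Fin.prod_univ_two, Matrix.of_apply] at this
    simp only [Matrix.cons_val, sub_self, K0] at this
    rw [this]; ring
  have E3 : ∀ a b c, a ≠ b → a ≠ c → b ≠ c → ((∫ ω, ξ a ω * ξ b ω * ξ c ω ∂P : ℝ) : ℂ)
      = σ^3 - σ * (fhat f (a-b) * fhat f (b-a) + fhat f (a-c) * fhat f (c-a)
        + fhat f (b-c) * fhat f (c-b)) + fhat f (a-b) * fhat f (b-c) * fhat f (c-a)
        + fhat f (a-c) * fhat f (c-b) * fhat f (b-a) := by
    intro a b c h1 h2 h3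
    have := hDPP 3 ![a,b,c] (by
      intro x y; fin_cases x <;> fin_cases y <;> simp [h1, h2, h3, h1.symm, h2.symm, h3.symm])
    rw [det3'] at this
    simp only [Fin.prod_univ_three] at this
    simp only [Matrix.cons_val, sub_self, K0] at this
    rw [this]; ring
  have E4 := hDPP 4 ![i,j,k,l] (by
      intro x y; fin_cases x <;> fin_cases y <;>
        simp [hij, hik, hil, hjk, hjl, hkl, hij.symm, hik.symm, hil.symm, hjk.symm, hjl.symm,
          hkl.symm])
  rw [det4] at E4
  simp only [Fin.prod_univ_four] at E4
  simp only [Matrix.cons_val, sub_self, K0] at E4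
  rw [expand4 P σ (hb i) (hb j) (hb k) (hb l) (hb' i) (hb' j) (hb' k) (hb' l)]
  simp only [Complex.ofReal_add, Complex.ofReal_sub, Complex.ofReal_mul, Complex.ofReal_pow]
  rw [E4, E3 _ _ _ hjk hjl hkl, E3 _ _ _ hik hil hkl, E3 _ _ _ hij hil hjl,
    E3 _ _ _ hij hik hjk, E2 _ _ hij, E2 _ _ hik, E2 _ _ hil, E2 _ _ hjk, E2 _ _ hjl, E2 _ _ hkl,
    E1, E1, E1, E1]
  ring

/-- the weight -/
noncomputable def wt (f : AddCircle (1:ℝ) → ℝ) (k : ℤ) : ℝ := if k = 0 then 1 else ‖fhat f k‖^2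

lemma wt_nonneg (f : AddCircle (1:ℝ) → ℝ) (k : ℤ) : 0 ≤ wt f k := by
  unfold wt; split_ifs <;> positivity

lemma wt_summable (f : AddCircle (1:ℝ) → ℝ) (hf_meas : Measurable f)
    (hf01 : ∀ t, f t ∈ Set.Icc (0:ℝ) 1) : Summable (wt f) := by
  have h := (fhat_summable f hf_meas hf01).add (hasSum_ite_eq (0:ℤ) (1:ℝ)).summable
  refine Summable.of_nonneg_of_le (wt_nonneg f) (fun k => ?_) h
  unfold wt
  split_ifs
  · have : 0 ≤ ‖fhat f k‖^2 := by positivity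
    linarith
  · simp

lemma arith9 (u x y z : ℝ) (hu : 0 ≤ u) (hx : 0 ≤ x) (hy : 0 ≤ y) (hz : 0 ≤ z)
    (hu1 : u ≤ 1) (hx1 : x ≤ 1) (hy1 : y ≤ 1) (hz1 : z ≤ 1) :
    u * u * (u * u) + x * x * (x * x) + y * y * (z * z) + u * z * (u * y) + u * z * (u * y)
     + u * x * (u * x) + u * x * (u * x) + x * z * (x * y) + x * z * (x * y)
     ≤ u ^ 2 + 5 * (x^2 + y^2 + z^2) := by
  have huu : u * u ≤ 1 := mul_le_one₀ hu1 hu hu1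
  have hxx : x * x ≤ 1 := mul_le_one₀ hx1 hx hx1
  have hzz : z * z ≤ 1 := mul_le_one₀ hz1 hz hz1
  have hzy : z * y ≤ 1 := mul_le_one₀ hz1 hy hy1
  have a1 := mul_le_mul_of_nonneg_left huu (mul_nonneg hu hu)
  have a2 := mul_le_mul_of_nonneg_left hxx (mul_nonneg hx hx)
  have a3 := mul_le_mul_of_nonneg_left hzz (mul_nonneg hy hy)
  have a4 := mul_le_mul_of_nonneg_left huu (mul_nonneg hz hy)
  have a5 := mul_le_mul_of_nonneg_left huu (mul_nonneg hx hx)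
  have a6 := mul_le_mul_of_nonneg_left hzy (mul_nonneg hx hx)
  nlinarith [sq_nonneg (z - y), sq_nonneg x, sq_nonneg y, sq_nonneg z]

lemma corr_bound (f : AddCircle (1:ℝ) → ℝ)
    (hf01 : ∀ t, f t ∈ Set.Icc (0:ℝ) 1)
    (σ : ℝ) (hσ : σ = ∫ t, f t ∂AddCircle.haarAddCircle)
    (hσ0 : 0 < σ) (hσ1 : σ < 1)
    {Ω : Type*} [MeasurableSpace Ω] (P : Measure Ω) [IsProbabilityMeasure P]
    (ξ : ℤ → Ω → ℝ) (hb : ∀ n, BM (ξ n)) (hb' : ∀ n, BM (fun ω => ξ n ω - σ))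
    (hDPP : ∀ (k : ℕ) (n : Fin k → ℤ), Function.Injective n →
      ((∫ ω, ∏ i, ξ (n i) ω ∂P : ℝ) : ℂ) =
        Matrix.det (Matrix.of fun i j => fhat f (n i - n j)))
    (n m h : ℤ) :
    ∫ ω, (ξ n ω - σ) * (ξ (n+h) ω - σ) * ((ξ m ω - σ) * (ξ (m+h) ω - σ)) ∂P ≤
      wt f h + 5 * (wt f (m - n) + wt f (m + h - n) + wt f (m - h - n)) := by
  have p0 := wt_nonneg f h
  have p1 := wt_nonneg f (m-n)
  have p2 := wt_nonneg f (m+h-n)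
  have p3 := wt_nonneg f (m-h-n)
  by_cases hd : h = 0 ∨ m - n = 0 ∨ m + h - n = 0 ∨ m - h - n = 0
  · have hle : ∫ ω, (ξ n ω - σ) * (ξ (n+h) ω - σ) * ((ξ m ω - σ) * (ξ (m+h) ω - σ)) ∂P ≤ 1 := by
      have hB := ((hb' n).mul (hb' (n+h))).mul ((hb' m).mul (hb' (m+h)))
      calc _ ≤ ∫ ω, (1:ℝ) ∂P := integral_mono (hB.integrable P) (integrable_const _)
              (fun ω => (le_abs_self _).trans (hB.2 ω))
        _ = 1 := by simp
    rcases hd with hd | hd | hd | hd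
    · have : wt f h = 1 := by simp [wt, hd]
      linarith
    · have : wt f (m-n) = 1 := by simp [wt, hd]
      linarith
    · have : wt f (m+h-n) = 1 := by simp [wt, hd]
      linarith
    · have : wt f (m-h-n) = 1 := by simp [wt, hd]
      linarith
  · push Not at hd
    obtain ⟨d0, d1, d2, d3⟩ := hd
    have key := corr4 f σ hσ hσ0 hσ1 P ξ hb hb' hDPP n (n+h) m (m+h) (by omega) (by omega)
      (by omega) (by omega) (by omega) (by omega)
    have sym : ∀ a b : ℤ, ‖fhat f (a - b)‖ = ‖fhat f (b - a)‖ := by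
      intro a b
      rw [← neg_sub, fhat_neg, RCLike.norm_conj]
    have key2 := congrArg norm key
    rw [Complex.norm_real] at key2
    refine (le_abs_self _).trans ?_
    rw [← Real.norm_eq_abs, key2]
    have s1 : ‖fhat f (n - (n+h))‖ = ‖fhat f h‖ := by rw [sym]; congr 2; ring
    have s1' : ‖fhat f ((n+h) - n)‖ = ‖fhat f h‖ := by congr 2; ring
    have s2 : ‖fhat f (m - (m+h))‖ = ‖fhat f h‖ := by rw [sym]; congr 2; ring
    have s2' : ‖fhat f ((m+h) - m)‖ = ‖fhat f h‖ := by congr 2; ring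
    have s3 : ‖fhat f (n - m)‖ = ‖fhat f (m-n)‖ := by rw [sym]
    have s4 : ‖fhat f (n + h - (m+h))‖ = ‖fhat f (m-n)‖ := by rw [sym]; congr 2; ring
    have s4' : ‖fhat f ((m+h) - (n + h))‖ = ‖fhat f (m-n)‖ := by congr 2; ring
    have s5 : ‖fhat f (n - (m+h))‖ = ‖fhat f (m+h-n)‖ := by rw [sym]
    have s6 : ‖fhat f (n + h - m)‖ = ‖fhat f (m-h-n)‖ := by rw [sym]; congr 2; ring
    have s6' : ‖fhat f (m - (n + h))‖ = ‖fhat f (m-h-n)‖ := by congr 2; ring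
    have nb := norm_fhat_le f hf01
    have ar := arith9 ‖fhat f h‖ ‖fhat f (m-n)‖ ‖fhat f (m+h-n)‖ ‖fhat f (m-h-n)‖
      (norm_nonneg _) (norm_nonneg _) (norm_nonneg _) (norm_nonneg _) (nb _) (nb _) (nb _) (nb _)
    simp only [wt, d0, d1, d2, d3, if_false]
    refine le_trans ?_ ar
    refine (norm_sub_le _ _).trans (add_le_add ((norm_sub_le _ _).trans (add_le_add
      ((norm_sub_le _ _).trans (add_le_add ((norm_sub_le _ _).trans (add_le_add
      ((norm_sub_le _ _).trans (add_le_add ((norm_sub_le _ _).trans (add_le_add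
      ((norm_add_le _ _).trans (add_le_add ((norm_add_le _ _).trans (add_le_add
      ?_ ?_)) ?_)) ?_)) ?_)) ?_)) ?_)) ?_)) ?_)
    all_goals
      simp only [norm_mul, s1, s1', s2, s2', s3, s4, s4', s5, s6, s6']
      apply le_of_eq
      ring

lemma sq_expand (b : ℕ → ℂ) (N : ℕ) :
    ‖∑ n ∈ range N, b n‖^2 + ∑ n ∈ range N, ‖b n‖^2 =
      2 * (∑ h ∈ range N, ∑ n ∈ range (N - h), b (n+h) * (starRingEnd ℂ) (b n)).re := by
  induction N with
  | zero => simp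
  | succ N ih =>
    have e : ∑ h ∈ range (N+1), ∑ n ∈ range (N + 1 - h), b (n+h) * (starRingEnd ℂ) (b n)
        = ∑ h ∈ range N, ∑ n ∈ range (N - h), b (n+h) * (starRingEnd ℂ) (b n)
          + b N * (starRingEnd ℂ) (∑ n ∈ range (N+1), b n) := by
      have e1 : ∀ h ∈ range (N+1), ∑ n ∈ range (N + 1 - h), b (n+h) * (starRingEnd ℂ) (b n)
          = ∑ n ∈ range (N - h), b (n+h) * (starRingEnd ℂ) (b n)
            + b N * (starRingEnd ℂ) (b (N - h)) := by
        intro h hh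
        have hh' : h ≤ N := by simpa [Nat.lt_succ_iff] using hh
        rw [show N + 1 - h = (N - h) + 1 by omega, sum_range_succ, Nat.sub_add_cancel hh']
      rw [sum_congr rfl e1, sum_add_distrib, sum_range_succ, map_sum, mul_sum,
        ← sum_range_reflect (fun j => b N * (starRingEnd ℂ) (b j))]
      simp
    rw [e, Complex.add_re, mul_add, ← ih, sum_range_succ, sum_range_succ]
    simp only [← Complex.normSq_eq_norm_sq, Complex.normSq_apply, map_add, Complex.add_re,
      Complex.add_im, Complex.mul_re, Complex.conj_re, Complex.conj_im]
    ring

/-- autocorrelation -/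
def acorr (a : ℕ → ℝ) (N h : ℕ) : ℝ := ∑ n ∈ range (N - h), a n * a (n+h)

lemma exp_sum_bound (a : ℕ → ℝ) (z : ℂ) (hz : ‖z‖ = 1) (N : ℕ) :
    ‖∑ n ∈ range N, (a n : ℂ) * z^n‖^4 ≤ 4 * N * ∑ h ∈ range N, (acorr a N h)^2 := by
  have h1 := sq_expand (fun n => (a n : ℂ) * z^n) N
  have h2 : ∀ h, ∑ n ∈ range (N - h), ((a (n+h) : ℂ) * z^(n+h)) * (starRingEnd ℂ) ((a n : ℂ) * z^n)
      = z^h * (acorr a N h : ℂ) := by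
    intro h
    unfold acorr
    push_cast
    rw [mul_sum]
    refine sum_congr rfl fun n _ => ?_
    have : z^n * (starRingEnd ℂ) (z^n) = 1 := by
      rw [Complex.mul_conj, Complex.normSq_eq_norm_sq, norm_pow, hz]; simp
    rw [map_mul, Complex.conj_ofReal, pow_add]
    linear_combination (a (n+h) : ℂ) * (a n) * z^h * this
  simp only [h2] at h1
  have h3 : ‖∑ n ∈ range N, (a n : ℂ) * z^n‖^2 ≤ 2 * ∑ h ∈ range N, |acorr a N h| := by
    have p : 0 ≤ ∑ n ∈ range N, ‖(a n : ℂ) * z^n‖^2 := sum_nonneg fun _ _ => by positivity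
    have q : (∑ h ∈ range N, z^h * (acorr a N h : ℂ)).re ≤ ∑ h ∈ range N, |acorr a N h| := by
      refine (Complex.re_le_norm _).trans ((norm_sum_le _ _).trans (le_of_eq ?_))
      refine sum_congr rfl fun h _ => ?_
      rw [norm_mul, norm_pow, hz]; simp
    linarith
  have h4 : (∑ h ∈ range N, |acorr a N h|)^2 ≤ N * ∑ h ∈ range N, (acorr a N h)^2 := by
    have := sq_sum_le_card_mul_sum_sq (s := range N) (f := fun h => |acorr a N h|)
    simpa using this
  calc _ = (‖∑ n ∈ range N, (a n : ℂ) * z^n‖^2)^2 := by ring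
    _ ≤ (2 * ∑ h ∈ range N, |acorr a N h|)^2 := by gcongr
    _ = 4 * (∑ h ∈ range N, |acorr a N h|)^2 := by ring
    _ ≤ _ := by linarith

lemma fill (b : ℕ → ℂ) (hb : ∀ n, ‖b n‖ ≤ 1)
    (h : Tendsto (fun k : ℕ => ‖∑ n ∈ range (k^2), b n‖ / ((k^2 : ℕ) : ℝ)) atTop (nhds 0)) :
    Tendsto (fun N : ℕ => (N:ℂ)⁻¹ * ∑ n ∈ range N, b n) atTop (nhds 0) := by
  have hs : Tendsto Nat.sqrt atTop atTop := by
    refine tendsto_atTop.2 fun c => ?_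
    filter_upwards [eventually_ge_atTop (c*c)] with n hn
    exact Nat.le_sqrt.2 hn
  have h2 : Tendsto (fun k : ℕ => ‖∑ n ∈ range (k^2), b n‖ / ((k^2 : ℕ) : ℝ) + 2 / (k:ℝ)) atTop
      (nhds 0) := by
    have := h.add (tendsto_const_div_atTop_nhds_zero_nat 2)
    simpa using this
  refine squeeze_zero_norm' ?_ (h2.comp hs)
  filter_upwards [eventually_ge_atTop 1] with N hN
  simp only [Function.comp]
  set k := Nat.sqrt N with hk
  have k1 : 1 ≤ k := Nat.le_sqrt.2 (by simpa using hN)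
  have k2 : k^2 ≤ N := Nat.sqrt_le' N
  have k3 : N ≤ k^2 + 2 * k := by
    have := Nat.sqrt_le_add N
    rw [← hk] at this
    nlinarith
  have kp : (0:ℝ) < k := by exact_mod_cast k1
  have k2' : ((k^2 : ℕ):ℝ) ≤ N := by exact_mod_cast k2
  have k2p : (0:ℝ) < ((k^2 : ℕ):ℝ) := by push_cast; positivity
  have hS : ‖∑ n ∈ range N, b n‖ ≤ ‖∑ n ∈ range (k^2), b n‖ + 2 * k := by
    rw [← sum_range_add_sum_Ico b k2]
    refine (norm_add_le _ _).trans (add_le_add le_rfl ?_)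
    refine (norm_sum_le_of_le _ (fun n _ => hb n)).trans ?_
    simp only [sum_const, Nat.card_Ico, nsmul_eq_mul, mul_one]
    have : N - k^2 ≤ 2 * k := by omega
    exact_mod_cast this
  rw [norm_mul, norm_inv, Complex.norm_natCast, inv_mul_eq_div]
  calc _ ≤ (‖∑ n ∈ range (k^2), b n‖ + 2 * k) / ((k^2 : ℕ):ℝ) := by gcongr
    _ = _ := by
      rw [add_div]; congr 1; push_cast; field_simp

lemma ae_zero {Ω : Type*} [MeasurableSpace Ω] (P : Measure Ω) (Y : ℕ → Ω → ℝ)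
    (hm : ∀ k, Measurable (Y k)) (hi : ∀ k, Integrable (Y k) P) (h0 : ∀ k ω, 0 ≤ Y k ω)
    (c : ℕ → ℝ) (hc : Summable c) (hle : ∀ k, ∫ ω, Y k ω ∂P ≤ c k) :
    ∀ᵐ ω ∂P, Tendsto (fun k => Y k ω) atTop (nhds 0) := by
  have h1 : ∫⁻ ω, ∑' k, ENNReal.ofReal (Y k ω) ∂P ≠ ∞ := by
    rw [lintegral_tsum (fun k => (hm k).ennreal_ofReal.aemeasurable)]
    refine ne_top_of_le_ne_top hc.tsum_ofReal_ne_top (ENNReal.tsum_le_tsum fun k => ?_)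
    rw [← ofReal_integral_eq_lintegral_ofReal (hi k) (ae_of_all _ (h0 k))]
    exact ENNReal.ofReal_le_ofReal (hle k)
  have h2 := ae_lt_top (Measurable.tsum (fun k => (hm k).ennreal_ofReal)) h1
  filter_upwards [h2] with ω hω
  have h3 := ENNReal.tendsto_atTop_zero_of_tsum_ne_top hω.ne
  have h4 := (ENNReal.tendsto_toReal (ENNReal.zero_ne_top)).comp h3
  simpa [Function.comp_def, ENNReal.toReal_ofReal (h0 _ ω)] using h4

lemma geom_zero (t : ℝ) (ht : t ∈ Set.Ioo (0:ℝ) 1) :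
    Tendsto (fun N : ℕ => (N:ℂ)⁻¹ * ∑ n ∈ range N,
      (Complex.exp (2 * Real.pi * Complex.I * t))^n) atTop (nhds 0) := by
  set z := Complex.exp (2 * Real.pi * Complex.I * t) with hz
  have hn : ‖z‖ = 1 := by
    rw [hz, show (2 * Real.pi * Complex.I * t : ℂ) = ((2 * Real.pi * t : ℝ) : ℂ) * Complex.I by
      push_cast; ring]
    exact Complex.norm_exp_ofReal_mul_I _
  have h1 : z ≠ 1 := by
    intro h
    rw [hz, Complex.exp_eq_one_iff] at h
    obtain ⟨n, hn⟩ := h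
    have hpi : (2 * Real.pi * Complex.I : ℂ) ≠ 0 := Complex.two_pi_I_ne_zero
    have : (t : ℂ) = n := by
      apply mul_left_cancel₀ hpi
      rw [hn]; ring
    have h2 : t = n := by exact_mod_cast this
    rw [h2] at ht
    have a := ht.1
    have b := ht.2
    norm_cast at a b
    omega
  have h3 : Tendsto (fun N : ℕ => (2 / ‖z - 1‖) / (N:ℝ)) atTop (nhds 0) :=
    tendsto_const_div_atTop_nhds_zero_nat _
  refine squeeze_zero_norm (fun N => ?_) h3
  rw [norm_mul, norm_inv, Complex.norm_natCast, inv_mul_eq_div, geom_sum_eq h1, norm_div]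
  gcongr
  refine (norm_sub_le _ _).trans ?_
  rw [norm_pow, hn]; norm_num

lemma sum_wt_le (f : AddCircle (1:ℝ) → ℝ) (hs : Summable (wt f)) (c : ℤ) (N : ℕ) :
    ∑ m ∈ range N, wt f (m + c) ≤ ∑' k, wt f k := by
  have hinj : Function.Injective (fun m : ℕ => (m:ℤ) + c) := fun a b h => by
    simpa using h
  have := hs.sum_le_tsum ((range N).map ⟨_, hinj⟩) (fun k _ => wt_nonneg f k)
  simpa [sum_map] using this

lemma V_bound (f : AddCircle (1:ℝ) → ℝ) (hf_meas : Measurable f)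
    (hf01 : ∀ t, f t ∈ Set.Icc (0:ℝ) 1)
    (σ : ℝ) (hσ : σ = ∫ t, f t ∂AddCircle.haarAddCircle)
    (hσ0 : 0 < σ) (hσ1 : σ < 1)
    {Ω : Type*} [MeasurableSpace Ω] (P : Measure Ω) [IsProbabilityMeasure P]
    (ξ : ℤ → Ω → ℝ) (hb : ∀ n, BM (ξ n)) (hb' : ∀ n, BM (fun ω => ξ n ω - σ))
    (hDPP : ∀ (k : ℕ) (n : Fin k → ℤ), Function.Injective n →
      ((∫ ω, ∏ i, ξ (n i) ω ∂P : ℝ) : ℂ) =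
        Matrix.det (Matrix.of fun i j => fhat f (n i - n j)))
    (N : ℕ) :
    Integrable (fun ω => ∑ h ∈ range N, (acorr (fun n => ξ n ω - σ) N h)^2) P ∧
    ∫ ω, ∑ h ∈ range N, (acorr (fun n => ξ n ω - σ) N h)^2 ∂P ≤
      16 * (∑' k, wt f k) * (N:ℝ)^2 := by
  have hs := wt_summable f hf_meas hf01
  set B := ∑' k, wt f k with hB
  have hB0 : 0 ≤ B := tsum_nonneg (wt_nonneg f)
  have hex : ∀ (h : ℕ) ω, (acorr (fun n => ξ n ω - σ) N h)^2 =
      ∑ n ∈ range (N - h), ∑ m ∈ range (N - h),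
        (ξ n ω - σ) * (ξ ((n:ℤ)+h) ω - σ) * ((ξ m ω - σ) * (ξ ((m:ℤ)+h) ω - σ)) := by
    intro h ω
    unfold acorr
    rw [sq, sum_mul_sum]
    push_cast
    rfl
  have hint : ∀ (n m h : ℤ), Integrable (fun ω =>
      (ξ n ω - σ) * (ξ (n+h) ω - σ) * ((ξ m ω - σ) * (ξ (m+h) ω - σ))) P := fun n m h =>
    (((hb' n).mul (hb' (n+h))).mul ((hb' m).mul (hb' (m+h)))).integrable P
  have hintX : ∀ h : ℕ, Integrable (fun ω => (acorr (fun n => ξ n ω - σ) N h)^2) P := by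
    intro h
    simp only [hex]
    exact integrable_finsetSum _ fun n _ => integrable_finsetSum _ fun m _ => hint n m h
  have hX : ∀ h : ℕ, ∫ ω, (acorr (fun n => ξ n ω - σ) N h)^2 ∂P ≤
      (N:ℝ)^2 * wt f h + 15 * B * N := by
    intro h
    simp only [hex]
    rw [integral_finsetSum _ fun (n : ℕ) _ => integrable_finsetSum _ fun (m : ℕ) _ => hint n m h]
    have hNh : ((N - h : ℕ) : ℝ) ≤ N := by exact_mod_cast Nat.sub_le N h
    have hrow : ∀ n ∈ range (N - h), ∫ ω, ∑ m ∈ range (N - h),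
        (ξ n ω - σ) * (ξ ((n:ℤ)+h) ω - σ) * ((ξ m ω - σ) * (ξ ((m:ℤ)+h) ω - σ)) ∂P
        ≤ N * wt f h + 15 * B := by
      intro n _
      rw [integral_finsetSum _ fun (m : ℕ) _ => hint n m h]
      have hle := sum_le_sum (s := range (N - h)) fun (m : ℕ) _ =>
        corr_bound f hf01 σ hσ hσ0 hσ1 P ξ hb hb' hDPP n m h
      refine hle.trans ?_
      rw [sum_add_distrib, ← mul_sum, sum_add_distrib, sum_add_distrib]
      have b1 := sum_wt_le f hs (-n) (N - h)
      have b2 := sum_wt_le f hs (h - n) (N - h)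
      have b3 := sum_wt_le f hs (-h - n) (N - h)
      have c1 : ∀ m : ℕ, (m:ℤ) - n = m + -n := fun m => by ring
      have c2 : ∀ m : ℕ, (m:ℤ) + h - n = m + (h - n) := fun m => by ring
      have c3 : ∀ m : ℕ, (m:ℤ) - h - n = m + (-h - n) := fun m => by ring
      simp only [c1, c2, c3, sum_const, card_range, nsmul_eq_mul] at b2 ⊢
      have := mul_le_mul_of_nonneg_right hNh (wt_nonneg f h)
      linarith
    refine (sum_le_sum hrow).trans ?_
    simp only [sum_const, card_range, nsmul_eq_mul]
    have h0 := wt_nonneg f h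
    have := mul_le_mul_of_nonneg_right hNh (show 0 ≤ N * wt f h + 15 * B by positivity)
    linarith
  refine ⟨integrable_finsetSum _ fun h _ => hintX h, ?_⟩
  rw [integral_finsetSum _ fun h _ => hintX h]
  refine (sum_le_sum fun h _ => hX h).trans ?_
  rw [sum_add_distrib, ← mul_sum]
  simp only [sum_const, card_range, nsmul_eq_mul]
  have b := sum_wt_le f hs 0 N
  simp only [add_zero] at b
  have := mul_le_mul_of_nonneg_left b (sq_nonneg (N:ℝ))
  linarith

/-- Almost surely, for every t ∈ (0,1), the averages
(1/N) ∑_{n=0}^{N−1} ξ_n e^{2πint} converge to 0 as N → ∞. -/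
theorem stmt_0
    (f : AddCircle (1:ℝ) → ℝ) (hf_meas : Measurable f)
    (hf01 : ∀ t, f t ∈ Set.Icc (0:ℝ) 1)
    (σ : ℝ) (hσ : σ = ∫ t, f t ∂AddCircle.haarAddCircle)
    (hσ0 : 0 < σ) (hσ1 : σ < 1)
    {Ω : Type*} [MeasurableSpace Ω] (P : Measure Ω) [IsProbabilityMeasure P]
    (ξ : ℤ → Ω → ℝ) (hξ_meas : ∀ n, Measurable (ξ n))
    (hξ01 : ∀ n ω, ξ n ω = 0 ∨ ξ n ω = 1)
    (hDPP : ∀ (k : ℕ) (n : Fin k → ℤ), Function.Injective n →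
      ((∫ ω, ∏ i, ξ (n i) ω ∂P : ℝ) : ℂ) =
        Matrix.det (Matrix.of fun i j => fhat f (n i - n j))) :
    ∀ᵐ ω ∂P, ∀ t ∈ Set.Ioo (0:ℝ) 1,
      Tendsto (fun N : ℕ => (N:ℂ)⁻¹ *
          ∑ n ∈ Finset.range N, (ξ (n:ℤ) ω : ℂ) *
            Complex.exp (2 * Real.pi * Complex.I * (n:ℂ) * (t:ℂ)))
        atTop (nhds 0) := by
  have hb : ∀ n, BM (ξ n) := fun n => ⟨hξ_meas n, fun ω => by
    rcases hξ01 n ω with h | h <;> simp [h]⟩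
  have hb' : ∀ n, BM (fun ω => ξ n ω - σ) := fun n => ⟨(hξ_meas n).sub_const σ, fun ω => by
    show |ξ n ω - σ| ≤ 1
    rcases hξ01 n ω with h | h <;> rw [h, abs_le] <;> constructor <;> linarith⟩
  have hV := V_bound f hf_meas hf01 σ hσ hσ0 hσ1 P ξ hb hb' hDPP
  set B := ∑' k, wt f k with hB
  let V : ℕ → Ω → ℝ := fun N ω => ∑ h ∈ range N, (acorr (fun n => ξ n ω - σ) N h)^2
  have hVm : ∀ N, Measurable (V N) := by
    intro N
    refine Finset.measurable_sum _ fun h _ => Measurable.pow_const ?_ 2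
    unfold acorr
    exact Finset.measurable_sum _ fun n _ => (hb' _).1.mul (hb' _).1
  have hVn : ∀ N ω, 0 ≤ V N ω := fun N ω => sum_nonneg fun _ _ => sq_nonneg _
  have hY := ae_zero P (fun k ω => V (k^2) ω / ((k^2 : ℕ) : ℝ)^3)
    (fun k => (hVm _).div_const _) (fun k => (hV (k^2)).1.div_const _)
    (fun k ω => div_nonneg (hVn _ _) (by positivity)) (fun k => 16 * B * (1 / (k:ℝ)^2))
    ((Real.summable_one_div_nat_pow.2 (by norm_num)).mul_left _) (by
      intro k
      rw [integral_div]
      refine (div_le_div_of_nonneg_right (hV (k^2)).2 (by positivity)).trans (le_of_eq ?_)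
      rcases Nat.eq_zero_or_pos k with h | h
      · simp [h]
      · push_cast
        field_simp)
  filter_upwards [hY] with ω hω t ht
  set z := Complex.exp (2 * Real.pi * Complex.I * t) with hz
  have hn : ‖z‖ = 1 := by
    rw [hz, show (2 * Real.pi * Complex.I * t : ℂ) = ((2 * Real.pi * t : ℝ) : ℂ) * Complex.I by
      push_cast; ring]
    exact Complex.norm_exp_ofReal_mul_I _
  have hzn : ∀ n : ℕ, Complex.exp (2 * Real.pi * Complex.I * (n:ℂ) * (t:ℂ)) = z^n := by
    intro n
    rw [hz, ← Complex.exp_nat_mul]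
    congr 1; ring
  have hA : Tendsto (fun N : ℕ => (N:ℂ)⁻¹ *
      ∑ n ∈ range N, (((ξ n ω - σ : ℝ) : ℂ) * z^n)) atTop (nhds 0) := by
    apply fill
    · intro n
      rw [norm_mul, norm_pow, hn, Complex.norm_real]
      simpa using (hb' n).2 ω
    · have h4 : Tendsto (fun k : ℕ => (‖∑ n ∈ range (k^2), (((ξ n ω - σ : ℝ) : ℂ) * z^n)‖
          / ((k^2 : ℕ) : ℝ))^4) atTop (nhds 0) := by
        have hω' := hω.const_mul 4
        rw [mul_zero] at hω'
        refine squeeze_zero (fun k => by positivity) (fun k => ?_) hω'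
        have hbd := exp_sum_bound (fun n => ξ n ω - σ) z hn (k^2)
        rw [div_pow]
        refine (div_le_div_of_nonneg_right hbd (by positivity)).trans (le_of_eq ?_)
        rcases Nat.eq_zero_or_pos k with h | h
        · simp [h]
        · have : ((k^2 : ℕ):ℝ) ≠ 0 := by positivity
          simp only [V]
          field_simp
      have h5 := h4.rpow_const (p := 1/4) (Or.inr (by norm_num))
      rw [Real.zero_rpow (by norm_num)] at h5
      refine h5.congr fun k => ?_
      rw [← Real.rpow_natCast, ← Real.rpow_mul (by positivity)]
      norm_num
  have hG := (geom_zero t ht).const_mul (σ : ℂ)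
  have hsum := hA.add hG
  simp only [mul_zero, add_zero] at hsum
  refine hsum.congr fun N => ?_
  simp only [hzn, ← hz]
  rw [mul_left_comm, ← mul_add, mul_sum, ← sum_add_distrib]
  congr 1
  refine sum_congr rfl fun n _ => ?_
  push_cast
  ring
end

section
/- Almost surely, 𝔛₊ is not syndetic: for every integer ℓ ≥ 1 there exist infinitely many n ∈ ℕ such that ξ_n = ξ_{n+1} = ⋯ = ξ_{n+ℓ−1} = 0, i.e. the gaps between consecutive elements of 𝔛₊ are unbounded. -/
open MeasureTheory Complex Filter Finset
open scoped ENNReal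

lemma det_add_one_expand {ι : Type} [Fintype ι] [DecidableEq ι] (M : Matrix ι ι ℂ) :
    (M + 1).det = ∑ S : Finset ι,
      (M.submatrix (Subtype.val : {i // i ∈ S} → ι) Subtype.val).det := by
  have h := (Matrix.detRowAlternating (n := ι) (R := ℂ)).map_add_univ M.row (1 : Matrix ι ι ℂ).row
  have h2 : (M + 1).det = Matrix.detRowAlternating (M.row + (1 : Matrix ι ι ℂ).row) := rfl
  rw [h2, h]
  refine Finset.sum_congr rfl fun S _ => ?_
  change Matrix.det (Matrix.of (S.piecewise M.row (1 : Matrix ι ι ℂ).row)) = _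
  rw [Matrix.twoBlockTriangular_det _ (fun i => i ∈ S)]
  · have e1 : (Matrix.toSquareBlockProp (Matrix.of (S.piecewise M.row (1 : Matrix ι ι ℂ).row))
        (fun i => ¬ i ∈ S)) = 1 := by
      ext i j
      rcases i with ⟨i, hi⟩
      rcases j with ⟨j, hj⟩
      simp [Matrix.toSquareBlockProp_def, Finset.piecewise, hi, Matrix.one_apply, Matrix.row]
    have e2 : (Matrix.toSquareBlockProp (Matrix.of (S.piecewise M.row (1 : Matrix ι ι ℂ).row))
        (fun i => i ∈ S)) = M.submatrix Subtype.val Subtype.val := by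
      ext i j
      rcases i with ⟨i, hi⟩
      rcases j with ⟨j, hj⟩
      simp [Matrix.toSquareBlockProp_def, Finset.piecewise, hi, Matrix.row]
    rw [e1, e2, Matrix.det_one, mul_one]
    congr!
  · intro i hi j hj
    have : i ≠ j := fun h => hi (h ▸ hj)
    simp [Finset.piecewise, hi, Matrix.row, Matrix.one_apply, this]

lemma det_one_sub_expand {ι : Type} [Fintype ι] [DecidableEq ι] (M : Matrix ι ι ℂ) :
    (1 - M).det = ∑ S : Finset ι, (-1) ^ S.card *
      (M.submatrix (Subtype.val : {i // i ∈ S} → ι) Subtype.val).det := by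
  rw [sub_eq_neg_add, det_add_one_expand]
  refine Finset.sum_congr rfl fun S _ => ?_
  have : (-M).submatrix (Subtype.val : {i // i ∈ S} → ι) (Subtype.val : {i // i ∈ S} → ι)
    = -(M.submatrix (Subtype.val : {i // i ∈ S} → ι) (Subtype.val : {i // i ∈ S} → ι)) := rfl
  rw [this, Matrix.det_neg]
  simp

lemma fhat_tendsto (f : AddCircle (1:ℝ) → ℝ) (hf_meas : Measurable f)
    (hf01 : ∀ t, f t ∈ Set.Icc (0:ℝ) 1) : Tendsto (fhat f) cofinite (nhds 0) := by
  have hm : MemLp (fun t => (f t : ℂ)) 2 (AddCircle.haarAddCircle (T := (1:ℝ))) := by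
    refine MemLp.of_bound (Complex.measurable_ofReal.comp hf_meas).aestronglyMeasurable 1 ?_
    refine Eventually.of_forall fun t => ?_
    simp only [Complex.norm_real, Real.norm_eq_abs]
    rw [abs_of_nonneg (hf01 t).1]; exact (hf01 t).2
  have h := (hasSum_sq_fourierCoeff (hm.toLp _)).summable.tendsto_cofinite_zero
  have h1 : ∀ k, fourierCoeff (hm.toLp _) k = fhat f k := fun k =>
    congrFun (fourierCoeff_congr_ae hm.coeFn_toLp) k
  simp only [h1] at h
  rw [tendsto_zero_iff_norm_tendsto_zero]
  have := (Real.continuous_sqrt.tendsto 0).comp h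
  simpa [Function.comp_def, Real.sqrt_sq] using this

lemma trig_ae_ne {ℓ : ℕ} (v : Fin ℓ → ℂ) (hv : v ≠ 0) :
    ∀ᵐ t ∂(AddCircle.haarAddCircle (T := (1:ℝ))),
      ∑ j, v j * fourier ((j : ℕ) : ℤ) t ≠ 0 := by
  classical
  have hna : NullSingletonClass (AddCircle.haarAddCircle (T := (1:ℝ))) := by
    have : (volume : Measure (AddCircle (1:ℝ))) = AddCircle.haarAddCircle := by
      rw [AddCircle.volume_eq_smul_haarAddCircle]; simp
    rw [← this]
    constructor
    intro x
    rw [← Metric.closedBall_zero, AddCircle.volume_closedBall]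
    simp
  let Q : Polynomial ℂ := ∑ j : Fin ℓ, Polynomial.monomial (j : ℕ) (v j)
  have hQ : Q ≠ 0 := by
    obtain ⟨i, hi⟩ := Function.ne_iff.mp hv
    intro h
    apply hi
    have := congrArg (fun q => Polynomial.coeff q (i:ℕ)) h
    simpa [Q, Polynomial.finsetSum_coeff, Polynomial.coeff_monomial, Fin.val_inj] using this
  have hfin : {t : AddCircle (1:ℝ) | (fun t => (AddCircle.toCircle t : ℂ)) t ∈ {z | Q.IsRoot z}}.Finite := by
    refine Set.Finite.preimage ?_ (Polynomial.finite_setOfPred_isRoot hQ)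
    exact (Subtype.val_injective.comp (AddCircle.injective_toCircle one_ne_zero)).injOn
  have h0 := hfin.measure_zero (AddCircle.haarAddCircle (T := (1:ℝ)))
  rw [ae_iff]
  refine measure_mono_null ?_ h0
  intro t ht
  simp only [ne_eq, not_not, Set.mem_ofPred_eq] at ht
  simp only [Set.mem_ofPred_eq, Polynomial.IsRoot, Q, Polynomial.eval_finsetSum,
    Polynomial.eval_monomial]
  rw [← ht]
  refine Finset.sum_congr rfl fun j _ => ?_
  rw [fourier_apply]
  simp [AddCircle.toCircle_nsmul]

lemma det_ne_zero' (f : AddCircle (1:ℝ) → ℝ) (hf_meas : Measurable f)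
    (hf01 : ∀ t, f t ∈ Set.Icc (0:ℝ) 1)
    (hσ1 : ∫ t, f t ∂AddCircle.haarAddCircle < 1) (ℓ : ℕ) :
    (1 - Matrix.of fun i j : Fin ℓ => fhat f (((i:ℕ):ℤ) - ((j:ℕ):ℤ))).det ≠ 0 := by
  intro hdet
  obtain ⟨v, hv, hMv⟩ := Matrix.exists_mulVec_eq_zero_iff.mpr hdet
  set μ := AddCircle.haarAddCircle (T := (1:ℝ))
  have hfi : Integrable f μ := by
    refine Integrable.of_bound hf_meas.aestronglyMeasurable 1 (Eventually.of_forall fun t => ?_)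
    rw [Real.norm_eq_abs, abs_of_nonneg (hf01 t).1]; exact (hf01 t).2
  have hgi : Integrable (fun t => ((1 - f t : ℝ) : ℂ)) μ := ((integrable_const 1).sub hfi).ofReal
  have hint : ∀ k : ℤ, Integrable (fun t => fourier k t * ((1 - f t : ℝ) : ℂ)) μ := fun k => by
    simpa using hgi.fourier_smul k
  have hentry : ∀ i j : Fin ℓ, (1 - Matrix.of fun i j : Fin ℓ => fhat f (((i:ℕ):ℤ) - ((j:ℕ):ℤ))) i j
      = ∫ t, fourier (((j:ℕ):ℤ) - ((i:ℕ):ℤ)) t * ((1 - f t : ℝ) : ℂ) ∂μ := by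
    intro i j
    have h1 : ∫ t, fourier (((j:ℕ):ℤ) - ((i:ℕ):ℤ)) t ∂μ = (1 : Matrix (Fin ℓ) (Fin ℓ) ℂ) i j := by
      have := fourierCoeff_fourier (T := (1:ℝ)) 0
      have := congrFun this (((i:ℕ):ℤ) - ((j:ℕ):ℤ))
      simp only [fourierCoeff, neg_sub, fourier_zero, smul_eq_mul, mul_one] at this
      rw [this, Pi.single_apply, Matrix.one_apply]
      congr 1
      simp [sub_eq_zero, Fin.ext_iff]
    have h2 : Integrable (fun t => fourier (((j:ℕ):ℤ) - ((i:ℕ):ℤ)) t * (f t : ℂ)) μ := by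
      simpa using (Integrable.ofReal (𝕜 := ℂ) hfi).fourier_smul (((j:ℕ):ℤ) - ((i:ℕ):ℤ))
    have h3 : Integrable (fun t => fourier (((j:ℕ):ℤ) - ((i:ℕ):ℤ)) t) μ := by
      simpa using (integrable_const (μ := μ) (1:ℂ)).fourier_smul (((j:ℕ):ℤ) - ((i:ℕ):ℤ))
    simp only [Matrix.sub_apply, Matrix.of_apply, ofReal_sub, ofReal_one, mul_sub, mul_one]
    rw [integral_sub h3 h2, h1]
    simp [fhat, fourierCoeff, μ]
  have hquad : ∫ t, ((1 - f t : ℝ) : ℂ) * ((‖∑ j, v j * fourier ((j : ℕ) : ℤ) t‖ ^ 2 : ℝ) : ℂ) ∂μ = 0 := by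
    have : ∀ t, ((1 - f t : ℝ) : ℂ) * ((‖∑ j, v j * fourier ((j : ℕ) : ℤ) t‖ ^ 2 : ℝ) : ℂ)
        = ∑ i, ∑ j, (starRingEnd ℂ (v i) * v j) * (fourier (((j:ℕ):ℤ) - ((i:ℕ):ℤ)) t * ((1 - f t : ℝ) : ℂ)) := by
      intro t
      push_cast
      rw [← Complex.conj_mul', map_sum, Finset.sum_mul_sum, Finset.mul_sum]
      refine Finset.sum_congr rfl fun i _ => ?_
      rw [Finset.mul_sum]
      refine Finset.sum_congr rfl fun j _ => ?_
      rw [sub_eq_add_neg ((j:ℕ):ℤ), fourier_add, fourier_neg, map_mul]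
      ring
    simp only [this]
    rw [integral_finsetSum _ fun i _ => integrable_finsetSum _ fun j _ => (hint _).const_mul _]
    refine Finset.sum_eq_zero fun i _ => ?_
    rw [integral_finsetSum _ fun j _ => (hint _).const_mul _]
    simp only [integral_const_mul, ← hentry]
    have := congrFun hMv i
    simp only [Matrix.mulVec, dotProduct, Pi.zero_apply] at this
    calc _ = starRingEnd ℂ (v i) * ∑ j, (1 - Matrix.of fun i j : Fin ℓ => fhat f (((i:ℕ):ℤ) - ((j:ℕ):ℤ))) i j * v j := by
          rw [Finset.mul_sum]; exact Finset.sum_congr rfl fun j _ => by ring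
      _ = 0 := by rw [this, mul_zero]
  have hquad' : ∫ t, (1 - f t) * ‖∑ j, v j * fourier ((j : ℕ) : ℤ) t‖ ^ 2 ∂μ = 0 := by
    have h := hquad
    simp only [← ofReal_mul] at h
    rw [integral_complex_ofReal] at h
    exact_mod_cast h
  have hcont : Continuous fun t : AddCircle (1:ℝ) => ‖∑ j, v j * fourier ((j : ℕ) : ℤ) t‖ ^ 2 := by
    fun_prop
  obtain ⟨C, hC⟩ := (isCompact_univ (X := AddCircle (1:ℝ))).exists_bound_of_continuousOn hcont.continuousOn
  have hintg : Integrable (fun t => (1 - f t) * ‖∑ j, v j * fourier ((j : ℕ) : ℤ) t‖ ^ 2) μ :=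
    ((integrable_const 1).sub hfi).mul_bdd hcont.aestronglyMeasurable
      (c := C) (Eventually.of_forall fun t => hC t trivial)
  rw [integral_eq_zero_iff_of_nonneg (fun t => mul_nonneg (by linarith [(hf01 t).2]) (by positivity)) hintg] at hquad'
  have hone : f =ᵐ[μ] fun _ => 1 := by
    filter_upwards [hquad', trig_ae_ne v hv] with t h1 h2
    simp only [Pi.zero_apply, mul_eq_zero] at h1
    rcases h1 with h1 | h1
    · linarith
    · exact absurd (by simpa using h1) h2
  rw [integral_congr_ae hone] at hσ1
  simp at hσ1

lemma second_moment {Ω : Type*} [MeasurableSpace Ω] (P : Measure Ω) [IsProbabilityMeasure P]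
    (X : ℕ → Ω → ℝ) (hm : ∀ n, Measurable (X n)) (h01 : ∀ n ω, X n ω ∈ Set.Icc (0:ℝ) 1)
    (p : ℝ) (hp : 0 < p) (hE : ∀ n, ∫ ω, X n ω ∂P = p)
    (hmix : ∀ ε > 0, ∃ d : ℕ, ∀ n m, n + d ≤ m → ∫ ω, X n ω * X m ω ∂P ≤ p ^ 2 + ε) :
    ∀ᵐ ω ∂P, ∀ N, ∃ n, N ≤ n ∧ X n ω ≠ 0 := by
  rw [ae_all_iff]
  intro N
  rw [ae_iff]
  set B := {ω | ¬ ∃ n, N ≤ n ∧ X n ω ≠ 0} with hB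
  have hBm : MeasurableSet B := by
    have : B = ⋂ n, ⋂ (_ : N ≤ n), X n ⁻¹' {0} := by
      ext ω; simp [hB]
    rw [this]
    exact MeasurableSet.iInter fun n => MeasurableSet.iInter fun _ => hm n (measurableSet_singleton 0)
  have hXi : ∀ n, Integrable (X n) P := fun n =>
    Integrable.of_bound (hm n).aestronglyMeasurable 1 (Eventually.of_forall fun ω => by
      rw [Real.norm_eq_abs, abs_of_nonneg (h01 n ω).1]; exact (h01 n ω).2)
  have hXX : ∀ n m, Integrable (fun ω => X n ω * X m ω) P := fun n m =>
    (hXi n).mul_bdd (c := 1) (hm m).aestronglyMeasurable (Eventually.of_forall fun ω => by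
      rw [Real.norm_eq_abs, abs_of_nonneg (h01 m ω).1]; exact (h01 m ω).2)
  have hcov : ∀ n m, Integrable (fun ω => (X n ω - p) * (X m ω - p)) P ∧
      ∫ ω, (X n ω - p) * (X m ω - p) ∂P = ∫ ω, X n ω * X m ω ∂P - p ^ 2 := by
    intro n m
    have e : (fun ω => (X n ω - p) * (X m ω - p)) =
      fun ω => (X n ω * X m ω - p * X n ω) - (p * X m ω - p ^ 2) := by ext ω; ring
    have i1 : Integrable (fun ω => X n ω * X m ω - p * X n ω) P := (hXX n m).sub ((hXi n).const_mul p)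
    have i2 : Integrable (fun ω => p * X m ω - p ^ 2) P := ((hXi m).const_mul p).sub (integrable_const (μ := P) (p ^ 2))
    rw [e]
    refine ⟨i1.sub i2, ?_⟩
    rw [integral_sub i1 i2, integral_sub (hXX n m) ((hXi n).const_mul p),
      integral_sub ((hXi m).const_mul p) (integrable_const _), integral_const_mul,
      integral_const_mul, hE, hE]
    simp
    ring
  have key : ∀ ε > 0, ∀ M : ℕ, P.real B * p ^ 2 * M ^ 2 ≤ M + M ^ 2 * ε := by
    intro ε hε M
    obtain ⟨d, hd⟩ := hmix ε hε
    let n : ℕ → ℕ := fun i => N + i * d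
    let S : Ω → ℝ := fun ω => ∑ i ∈ range M, (X (n i) ω - p)
    have hS2 : ∀ ω, S ω ^ 2 = ∑ i ∈ range M, ∑ j ∈ range M,
        (X (n i) ω - p) * (X (n j) ω - p) := fun ω => by
      rw [sq, Finset.sum_mul_sum]
    have hSi : Integrable (fun ω => S ω ^ 2) P := by
      simp only [hS2]
      exact integrable_finsetSum _ fun i _ => integrable_finsetSum _ fun j _ => (hcov _ _).1
    have up : ∫ ω, S ω ^ 2 ∂P ≤ M + M ^ 2 * ε := by
      simp only [hS2]
      rw [integral_finsetSum _ fun i _ => integrable_finsetSum _ fun j _ => (hcov _ _).1]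
      have : ∀ i ∈ range M, ∫ ω, ∑ j ∈ range M, (X (n i) ω - p) * (X (n j) ω - p) ∂P
          ≤ ∑ j ∈ range M, ((if i = j then 1 else 0) + ε) := by
        intro i _
        rw [integral_finsetSum _ fun j _ => (hcov _ _).1]
        refine Finset.sum_le_sum fun j _ => ?_
        rw [(hcov _ _).2]
        rcases lt_trichotomy i j with h | h | h
        · have := hd (n i) (n j) (by simp only [n]; nlinarith)
          simp only [h.ne, if_false]; linarith
        · subst h
          have : ∫ ω, X (n i) ω * X (n i) ω ∂P ≤ ∫ ω, 1 ∂P :=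
            integral_mono (hXX _ _) (integrable_const _) fun ω =>
              mul_le_one₀ (h01 _ ω).2 (h01 _ ω).1 (h01 _ ω).2
          simp at this ⊢
          nlinarith [sq_nonneg p]
        · have := hd (n j) (n i) (by simp only [n]; nlinarith)
          simp only [mul_comm (X (n i) _)]
          simp only [h.ne', if_false]; linarith
      refine (Finset.sum_le_sum this).trans (le_of_eq ?_)
      simp [Finset.sum_add_distrib]
      rw [Finset.filter_true_of_mem (by simp)]
      simp; ring
    have low : P.real B * p ^ 2 * M ^ 2 ≤ ∫ ω, S ω ^ 2 ∂P := by
      have : ∫ ω, B.indicator (fun _ => p ^ 2 * M ^ 2) ω ∂P = P.real B * p ^ 2 * M ^ 2 := by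
        rw [integral_indicator_const _ hBm]; simp; ring
      rw [← this]
      refine integral_mono ((integrable_const _).indicator hBm) hSi fun ω => ?_
      by_cases hω : ω ∈ B
      · have hz : ∀ i, X (n i) ω = 0 := by
          intro i
          by_contra h
          exact hω ⟨n i, by simp [n], h⟩
        simp [Set.indicator_of_mem hω, S, hz]
        apply le_of_eq; ring
      · simp [Set.indicator_of_notMem hω]; positivity
    exact low.trans up
  have hz : P.real B = 0 := by
    by_contra hne
    have hpos : 0 < P.real B := lt_of_le_of_ne measureReal_nonneg (Ne.symm hne)
    set c := P.real B * p ^ 2 with hc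
    have hcpos : 0 < c := by positivity
    obtain ⟨M, hM⟩ := exists_nat_gt (2 / c)
    have := key (c / 2) (by positivity) M
    have hM0 : (0:ℝ) < M := lt_trans (by positivity) hM
    rw [div_lt_iff₀ hcpos] at hM
    nlinarith
  exact (measureReal_eq_zero_iff).mp hz


lemma dpp_gen (f : AddCircle (1:ℝ) → ℝ) {Ω : Type*} [MeasurableSpace Ω] (P : Measure Ω)
    (ξ : ℤ → Ω → ℝ)
    (hDPP : ∀ (k : ℕ) (n : Fin k → ℤ), Function.Injective n →
      ((∫ ω, ∏ i, ξ (n i) ω ∂P : ℝ) : ℂ) =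
        Matrix.det (Matrix.of fun i j => fhat f (n i - n j)))
    {ι : Type} [Fintype ι] [DecidableEq ι] (n : ι → ℤ) (hn : Function.Injective n) :
    ((∫ ω, ∏ i, ξ (n i) ω ∂P : ℝ) : ℂ) =
        Matrix.det (Matrix.of fun i j => fhat f (n i - n j)) := by
  let e := Fintype.equivFin ι
  have h := hDPP _ (n ∘ e.symm) (hn.comp e.symm.injective)
  have h1 : ∀ ω, ∏ i, ξ ((n ∘ e.symm) i) ω = ∏ i, ξ (n i) ω := fun ω =>
    e.symm.prod_comp (fun i => ξ (n i) ω)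
  simp only [h1] at h
  rw [h, ← Matrix.det_submatrix_equiv_self e.symm]
  rfl

lemma dpp_compl (f : AddCircle (1:ℝ) → ℝ) {Ω : Type*} [MeasurableSpace Ω] (P : Measure Ω)
    [IsProbabilityMeasure P]
    (ξ : ℤ → Ω → ℝ) (hξ_meas : ∀ n, Measurable (ξ n))
    (hξ01 : ∀ n ω, ξ n ω = 0 ∨ ξ n ω = 1)
    (hDPP : ∀ (k : ℕ) (n : Fin k → ℤ), Function.Injective n →
      ((∫ ω, ∏ i, ξ (n i) ω ∂P : ℝ) : ℂ) =
        Matrix.det (Matrix.of fun i j => fhat f (n i - n j)))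
    {ι : Type} [Fintype ι] [DecidableEq ι] (n : ι → ℤ) (hn : Function.Injective n) :
    ((∫ ω, ∏ i, (1 - ξ (n i) ω) ∂P : ℝ) : ℂ) =
        Matrix.det (1 - Matrix.of fun i j => fhat f (n i - n j)) := by
  have hexp : ∀ ω, ∏ i, (1 - ξ (n i) ω) =
      ∑ S : Finset ι, (-1) ^ S.card * ∏ i ∈ S, ξ (n i) ω := fun ω => by
    simp only [sub_eq_add_neg]
    rw [Finset.prod_one_add, Finset.powerset_univ]
    refine Finset.sum_congr rfl fun S _ => ?_
    rw [Finset.prod_neg]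
  have hint : ∀ S : Finset ι, Integrable (fun ω => ∏ i ∈ S, ξ (n i) ω) P := fun S => by
    refine Integrable.of_bound (Finset.measurable_prod S fun i _ =>
      hξ_meas (n i)).aestronglyMeasurable 1 (Eventually.of_forall fun ω => ?_)
    rw [norm_prod]
    refine Finset.prod_le_one (fun i _ => norm_nonneg _) fun i _ => ?_
    rcases hξ01 (n i) ω with h | h <;> simp [h]
  simp only [hexp]
  rw [integral_finsetSum _ fun S _ => (hint S).const_mul _, det_one_sub_expand]
  push_cast
  refine Finset.sum_congr rfl fun S _ => ?_
  rw [integral_const_mul]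
  push_cast
  congr 1
  have h := dpp_gen f P ξ hDPP (fun i : {i // i ∈ S} => n i) (hn.comp Subtype.val_injective)
  have h1 : ∀ ω, ∏ i : {i // i ∈ S}, ξ (n i) ω = ∏ i ∈ S, ξ (n i) ω := fun ω =>
    Finset.prod_coe_sort S (fun i => ξ (n i) ω)
  simp only [h1] at h
  rw [h]
  rfl

lemma dpp_zero_block (f : AddCircle (1:ℝ) → ℝ) (hf_meas : Measurable f)
    (hf01 : ∀ t, f t ∈ Set.Icc (0:ℝ) 1)
    (hσ1 : ∫ t, f t ∂AddCircle.haarAddCircle < 1)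
    {Ω : Type*} [MeasurableSpace Ω] (P : Measure Ω) [IsProbabilityMeasure P]
    (ξ : ℤ → Ω → ℝ) (hξ_meas : ∀ n, Measurable (ξ n))
    (hξ01 : ∀ n ω, ξ n ω = 0 ∨ ξ n ω = 1)
    (hDPP : ∀ (k : ℕ) (n : Fin k → ℤ), Function.Injective n →
      ((∫ ω, ∏ i, ξ (n i) ω ∂P : ℝ) : ℂ) =
        Matrix.det (Matrix.of fun i j => fhat f (n i - n j))) (ℓ : ℕ) :
    ∀ᵐ ω ∂P, ∀ N, ∃ n : ℕ, N ≤ n ∧ ∏ j : Fin ℓ, (1 - ξ ((n:ℤ) + ((j:ℕ):ℤ)) ω) ≠ 0 := by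
  set K : Matrix (Fin ℓ) (Fin ℓ) ℂ :=
    1 - Matrix.of fun i j : Fin ℓ => fhat f (((i:ℕ):ℤ) - ((j:ℕ):ℤ)) with hK
  have hb : ∀ n ω, 1 - ξ n ω ∈ Set.Icc (0:ℝ) 1 := fun n ω => by
    rcases hξ01 n ω with h | h <;> simp [h]
  let X : ℕ → Ω → ℝ := fun n ω => ∏ j : Fin ℓ, (1 - ξ ((n:ℤ) + ((j:ℕ):ℤ)) ω)
  have hX01 : ∀ n ω, X n ω ∈ Set.Icc (0:ℝ) 1 := fun n ω =>
    ⟨Finset.prod_nonneg fun j _ => (hb _ ω).1,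
      Finset.prod_le_one (fun j _ => (hb _ ω).1) fun j _ => (hb _ ω).2⟩
  have hEX : ∀ n, ((∫ ω, X n ω ∂P : ℝ) : ℂ) = K.det := fun n => by
    have h := dpp_compl f P ξ hξ_meas hξ01 hDPP (fun j : Fin ℓ => (n:ℤ) + ((j:ℕ):ℤ))
      (fun i j h => by ext; simpa using h)
    simpa [X, hK] using h
  set p := ∫ ω, X 0 ω ∂P with hp
  have hE : ∀ n, ∫ ω, X n ω ∂P = p := fun n => by
    have := (hEX n).trans (hEX 0).symm
    exact_mod_cast this
  have hppos : 0 < p := by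
    refine lt_of_le_of_ne (integral_nonneg fun ω => (hX01 0 ω).1) fun h => ?_
    have h2 := hEX 0
    rw [← hp, ← h] at h2
    exact det_ne_zero' f hf_meas hf01 hσ1 ℓ (by simpa using h2.symm)
  refine second_moment P X
    (fun n => Finset.measurable_prod _ fun j _ => measurable_const.sub (hξ_meas _))
    hX01 p hppos hE ?_
  -- asymptotic decorrelation
  let D : ℤ → Matrix (Fin ℓ ⊕ Fin ℓ) (Fin ℓ ⊕ Fin ℓ) ℂ := fun d =>
    Matrix.fromBlocks K (Matrix.of fun i j : Fin ℓ => -fhat f (((i:ℕ):ℤ) - ((j:ℕ):ℤ) - d))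
      (Matrix.of fun i j : Fin ℓ => -fhat f (((i:ℕ):ℤ) - ((j:ℕ):ℤ) + d)) K
  have hXX : ∀ n m : ℕ, n + ℓ ≤ m →
      ((∫ ω, X n ω * X m ω ∂P : ℝ) : ℂ) = (D ((m:ℤ) - n)).det := by
    intro n m hnm
    have h := dpp_compl f P ξ hξ_meas hξ01 hDPP
      (Sum.elim (fun j : Fin ℓ => (n:ℤ) + ((j:ℕ):ℤ)) (fun j : Fin ℓ => (m:ℤ) + ((j:ℕ):ℤ))) (by
        rintro (i | i) (j | j) h
        · simp at h; simp [Fin.ext_iff, h]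
        · have := i.2; simp at h; omega
        · have := j.2; simp at h; omega
        · simp at h; simp [Fin.ext_iff, h])
    simp only [Fintype.prod_sum_type, Sum.elim_inl, Sum.elim_inr] at h
    rw [h]
    congr 1
    ext (i | i) (j | j)
    · simp [D, hK, Matrix.one_apply]
    · simp [D]; congr 1; ring
    · simp [D]; congr 1; ring
    · simp [D, hK, Matrix.one_apply]
  have hcast : Tendsto (fun d : ℕ => (d : ℤ)) atTop atTop := tendsto_natCast_atTop_atTop
  have hlim : Tendsto (fun d : ℕ => D (d : ℤ)) atTop (nhds (Matrix.fromBlocks K 0 0 K)) := by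
    have hf0 := fhat_tendsto f hf_meas hf01
    refine tendsto_pi_nhds.mpr fun i => tendsto_pi_nhds.mpr fun j => ?_
    rcases i with i | i <;> rcases j with j | j
    · exact tendsto_const_nhds
    · have hinj : Function.Injective fun d : ℕ => ((i:ℕ):ℤ) - ((j:ℕ):ℤ) - (d:ℤ) :=
        fun a b h => by simpa using h
      have h := (hf0.comp hinj.tendsto_cofinite).neg
      rw [Nat.cofinite_eq_atTop, neg_zero] at h
      exact h
    · have hinj : Function.Injective fun d : ℕ => ((i:ℕ):ℤ) - ((j:ℕ):ℤ) + (d:ℤ) :=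
        fun a b h => by simpa using h
      have h := (hf0.comp hinj.tendsto_cofinite).neg
      rw [Nat.cofinite_eq_atTop, neg_zero] at h
      exact h
    · exact tendsto_const_nhds
  have hdet : Tendsto (fun d : ℕ => (D (d : ℤ)).det.re) atTop (nhds (p ^ 2)) := by
    have h1 := (Continuous.matrix_det continuous_id).tendsto (Matrix.fromBlocks K 0 0 K)
    have h2 := (Complex.continuous_re.tendsto _).comp (h1.comp hlim)
    have h3 : (Matrix.fromBlocks K 0 0 K).det.re = p ^ 2 := by
      rw [Matrix.det_fromBlocks_zero₂₁, ← hEX 0, ← hp, ← ofReal_mul, ofReal_re, sq]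
    simp only [id] at h2
    rw [h3] at h2
    exact h2
  intro ε hε
  obtain ⟨d, hd⟩ := (hdet.eventually (gt_mem_nhds (lt_add_of_pos_right (p ^ 2) hε))).exists_forall_of_atTop
  refine ⟨max d ℓ, fun n m hnm => ?_⟩
  have h1 := hXX n m (by have := le_max_right d ℓ; omega)
  have h2 := hd (m - n) (by have := le_max_left d ℓ; omega)
  rw [Nat.cast_sub (by omega), ← h1, ofReal_re] at h2
  exact h2.le

/-- Almost surely, 𝔛₊ is not syndetic: for every ℓ ≥ 1 there are infinitely many
n ∈ ℕ with ξ_n = ξ_{n+1} = ⋯ = ξ_{n+ℓ−1} = 0. -/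
theorem stmt_5
    (f : AddCircle (1:ℝ) → ℝ) (hf_meas : Measurable f)
    (hf01 : ∀ t, f t ∈ Set.Icc (0:ℝ) 1)
    (σ : ℝ) (hσ : σ = ∫ t, f t ∂AddCircle.haarAddCircle)
    (hσ0 : 0 < σ) (hσ1 : σ < 1)
    {Ω : Type*} [MeasurableSpace Ω] (P : Measure Ω) [IsProbabilityMeasure P]
    (ξ : ℤ → Ω → ℝ) (hξ_meas : ∀ n, Measurable (ξ n))
    (hξ01 : ∀ n ω, ξ n ω = 0 ∨ ξ n ω = 1)
    (hDPP : ∀ (k : ℕ) (n : Fin k → ℤ), Function.Injective n →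
      ((∫ ω, ∏ i, ξ (n i) ω ∂P : ℝ) : ℂ) =
        Matrix.det (Matrix.of fun i j => fhat f (n i - n j))) :
    ∀ᵐ ω ∂P, ∀ ℓ : ℕ, 1 ≤ ℓ → ∀ N : ℕ, ∃ n : ℕ, N ≤ n ∧
      ∀ j : ℕ, j < ℓ → ξ ((n:ℤ) + (j:ℤ)) ω = 0 := by
  rw [ae_all_iff]
  intro ℓ
  have h := dpp_zero_block f hf_meas hf01 (hσ ▸ hσ1) P ξ hξ_meas hξ01 hDPP ℓ
  filter_upwards [h] with ω hω
  intro _ N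
  obtain ⟨n, hn, hne⟩ := hω N
  refine ⟨n, hn, fun j hj => ?_⟩
  have h1 := Finset.prod_ne_zero_iff.mp hne ⟨j, hj⟩ (Finset.mem_univ _)
  rcases hξ01 ((n:ℤ) + (j:ℤ)) ω with h2 | h2
  · exact h2
  · simp [h2] at h1
end

section
/- Khintchine–Kahane inequality: assume additionally that f is not m-a.e. equal to an indicator function. Then for every p ∈ [2, ∞) and every finitely supported complex sequence (a_n)_{n∈ℤ}, writing S = ∑_{n∈ℤ} a_n (ξ_n − σ), one has ‖S‖_{L²(ℙ)} ≤ ‖S‖_{L^p(ℙ)} ≤ C_f(p) ‖S‖_{L²(ℙ)}, where C_f(p) = 2√2 · Γ(p/2 + 1)^{1/p} / √(∫_𝕋 f(1−f) dm) and Γ is the Gamma function. -/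
open MeasureTheory Complex Filter Finset
open scoped ENNReal

lemma kk_det_one_add {n R : Type*} [Fintype n] [DecidableEq n] [CommRing R] (M : Matrix n n R) :
    (1 + M).det = ∑ s : Finset n, (M.submatrix (Subtype.val : s → n) (Subtype.val : s → n)).det := by
  rw [add_comm]
  have h := (Matrix.detRowAlternating : (n → R) [⋀^n]→ₗ[R] R).map_add_univ
    M.row (1 : Matrix n n R).row
  change (M + 1).det = _ at h
  rw [h]
  exact Finset.sum_congr rfl fun s _ => Matrix.det_piecewise_one_eq_submatrix_det M s

open scoped ComplexOrder in
lemma kk_det_le {n : Type*} [Fintype n] [DecidableEq n] (M : Matrix n n ℂ) (hM : M.PosSemidef)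
    (q : ℝ) (hd : ∀ i, M i i = q) : M.det.re ≤ q ^ Fintype.card n := by
  rw [hM.isHermitian.det_eq_prod_eigenvalues]
  set e := hM.isHermitian.eigenvalues with he
  have he0 : ∀ i, 0 ≤ e i := fun i => hM.eigenvalues_nonneg i
  have htr : ∑ i, e i = Fintype.card n * q := by
    have h1 := hM.isHermitian.trace_eq_sum_eigenvalues
    simp only [Matrix.trace, Matrix.diag, hd] at h1
    have h2 := congrArg Complex.re h1
    simp at h2
    exact h2.symm
  have : (∏ i, ((e i : ℝ) : ℂ)).re = ∏ i, e i := by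
    rw [← Complex.ofReal_prod, Complex.ofReal_re]
  change (∏ i, ((e i : ℝ) : ℂ)).re ≤ _
  rw [this]
  rcases isEmpty_or_nonempty n with h | h
  · simp
  have hc : (0:ℝ) < Fintype.card n := by exact_mod_cast Fintype.card_pos
  have h3 := Real.geom_mean_le_arith_mean Finset.univ (fun _ : n => (1:ℝ)) e (by simp)
    (by simpa using hc) (by simpa using he0)
  simp only [Real.rpow_one, one_mul, htr, Finset.sum_const, Finset.card_univ, nsmul_eq_mul,
    mul_one] at h3
  rw [mul_div_cancel_left₀ _ hc.ne'] at h3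
  have hp : 0 ≤ ∏ i, e i := Finset.prod_nonneg fun i _ => he0 i
  calc ∏ i, e i = ((∏ i, e i) ^ ((Fintype.card n : ℝ)⁻¹)) ^ Fintype.card n := by
        rw [Real.rpow_inv_natCast_pow hp Fintype.card_ne_zero]
    _ ≤ _ := by gcongr

noncomputable abbrev kkμ : Measure (AddCircle (1:ℝ)) := AddCircle.haarAddCircle

lemma kk_fhat (f : AddCircle (1:ℝ) → ℝ) (k : ℤ) :
    fhat f k = ∫ t, fourier (-k) t * (f t : ℂ) ∂kkμ := by
  simp [fhat, fourierCoeff]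

lemma kk_int_fourier (k : ℤ) : ∫ t, fourier k t ∂kkμ = if k = 0 then (1:ℂ) else 0 := by
  have h := congrFun (fourierCoeff_fourier (T := 1) k) 0
  simp only [fourierCoeff, neg_zero, fourier_zero, one_smul, Pi.single_apply] at h
  rw [h]; simp [eq_comm]

lemma kk_integrable (g : AddCircle (1:ℝ) → ℂ) (hg : Measurable g) (C : ℝ) (h : ∀ t, ‖g t‖ ≤ C) :
    Integrable g kkμ :=
  Integrable.of_bound hg.aestronglyMeasurable C (Eventually.of_forall h)

lemma kk_norm_fourier (k : ℤ) (t : AddCircle (1:ℝ)) : ‖(fourier k t : ℂ)‖ = 1 := by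
  rw [fourier_apply]; exact Circle.norm_coe _

lemma kk_meas_fourier (k : ℤ) : Measurable (fun t : AddCircle (1:ℝ) => (fourier k t : ℂ)) :=
  (fourier k).continuous.measurable

lemma kk_fhat_neg (f : AddCircle (1:ℝ) → ℝ) (k : ℤ) : fhat f (-k) = star (fhat f k) := by
  rw [kk_fhat, kk_fhat]
  change _ = (starRingEnd ℂ) _
  rw [← integral_conj]
  congr 1; ext t
  rw [map_mul, ← fourier_neg]; simp

lemma kk_fhat_zero (f : AddCircle (1:ℝ) → ℝ) : fhat f 0 = ((∫ t, f t ∂kkμ : ℝ) : ℂ) := by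
  rw [kk_fhat]; simp only [neg_zero, fourier_zero, one_mul]; exact integral_ofReal

lemma kk_fhat_compl (f : AddCircle (1:ℝ) → ℝ) (hf_meas : Measurable f)
    (hf01 : ∀ t, f t ∈ Set.Icc (0:ℝ) 1) (k : ℤ) :
    fhat (fun t => 1 - f t) k = (if k = 0 then 1 else 0) - fhat f k := by
  rw [kk_fhat, kk_fhat]
  have h := kk_int_fourier (-k)
  simp only [neg_eq_zero] at h
  rw [← h, ← integral_sub]
  · congr 1; ext t; push_cast; ring
  · exact kk_integrable _ (kk_meas_fourier _) 1 (fun t => (kk_norm_fourier _ _).le)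
  · refine kk_integrable _ ((kk_meas_fourier _).mul (by fun_prop)) 1 (fun t => ?_)
    rw [norm_mul, kk_norm_fourier, one_mul, Complex.norm_real, Real.norm_eq_abs]
    exact abs_le.2 ⟨by linarith [(hf01 t).1], (hf01 t).2⟩

open scoped ComplexOrder in
lemma kk_posSemidef (f : AddCircle (1:ℝ) → ℝ) (hf_meas : Measurable f)
    (hf01 : ∀ t, f t ∈ Set.Icc (0:ℝ) 1) {ι : Type*} [Fintype ι] [DecidableEq ι] (n : ι → ℤ) :
    (Matrix.of fun i j => fhat f (n i - n j)).PosSemidef := by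
  refine .of_dotProduct_mulVec_nonneg ?_ (fun x => ?_)
  · ext i j
    simp only [Matrix.conjTranspose_apply, Matrix.of_apply]
    rw [← kk_fhat_neg]; congr 1; ring
  · have key : star x ⬝ᵥ (Matrix.of (fun i j => fhat f (n i - n j))).mulVec x =
        ((∫ t, f t * ‖∑ i, x i * fourier (n i) t‖ ^ 2 ∂kkμ : ℝ) : ℂ) := by
      rw [← integral_complex_ofReal]
      simp only [dotProduct, Matrix.mulVec, Matrix.of_apply, Finset.mul_sum, Pi.star_apply]
      have hi : ∀ i j, Integrable (fun t => star (x i) * (fourier (-(n i - n j)) t * (f t : ℂ) * x j)) kkμ := by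
        intro i j
        refine Integrable.const_mul (Integrable.mul_const ?_ _) _
        refine kk_integrable _ ((kk_meas_fourier _).mul (by fun_prop)) 1 (fun t => ?_)
        rw [norm_mul, kk_norm_fourier, one_mul, Complex.norm_real, Real.norm_eq_abs]
        exact abs_le.2 ⟨by linarith [(hf01 t).1], (hf01 t).2⟩
      have : ∀ i j, star (x i) * (fhat f (n i - n j) * x j) =
          ∫ t, star (x i) * (fourier (-(n i - n j)) t * (f t : ℂ) * x j) ∂kkμ := by
        intro i j
        rw [integral_const_mul, integral_mul_const, kk_fhat]
      simp_rw [this]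
      rw [Finset.sum_congr rfl (fun i _ => (integral_finsetSum _ (fun j _ => hi i j)).symm),
        ← integral_finsetSum _ (fun i _ => integrable_finsetSum _ (fun j _ => hi i j))]
      congr 1; ext t
      rw [Complex.ofReal_mul, Complex.ofReal_pow, ← Complex.conj_mul', map_sum, Finset.sum_mul_sum,
        Finset.mul_sum]
      refine Finset.sum_congr rfl fun i _ => ?_
      rw [Finset.mul_sum]
      refine Finset.sum_congr rfl fun j _ => ?_
      rw [map_mul, ← fourier_neg, neg_sub, sub_eq_neg_add, fourier_add]
      simp only [starRingEnd_apply]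
      ring
    rw [key]
    exact_mod_cast integral_nonneg fun t => mul_nonneg (hf01 t).1 (by positivity)

section kkprob
variable {Ω : Type*} [MeasurableSpace Ω] (P : Measure Ω) [IsProbabilityMeasure P]

lemma kk_integrable_prod (ξ : ℤ → Ω → ℝ) (hξ_meas : ∀ n, Measurable (ξ n))
    (hξ01 : ∀ n ω, ξ n ω = 0 ∨ ξ n ω = 1) {ι : Type*} (s : Finset ι) (n : ι → ℤ) :
    Integrable (fun ω => ∏ i ∈ s, ξ (n i) ω) P := by
  refine Integrable.of_bound (Finset.measurable_fun_prod s
    (fun i _ => hξ_meas (n i))).aestronglyMeasurable 1 (Eventually.of_forall fun ω => ?_)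
  rw [norm_prod]
  refine Finset.prod_le_one (fun i _ => norm_nonneg _) fun i _ => ?_
  rcases hξ01 (n i) ω with h | h <;> simp [h]

lemma kk_dpp (f : AddCircle (1:ℝ) → ℝ) (ξ : ℤ → Ω → ℝ)
    (hDPP : ∀ (k : ℕ) (n : Fin k → ℤ), Function.Injective n →
      ((∫ ω, ∏ i, ξ (n i) ω ∂P : ℝ) : ℂ) =
        Matrix.det (Matrix.of fun i j => fhat f (n i - n j)))
    {ι : Type*} [Fintype ι] [DecidableEq ι] (n : ι → ℤ) (hn : Function.Injective n) :
    ((∫ ω, ∏ i, ξ (n i) ω ∂P : ℝ) : ℂ) =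
        Matrix.det (Matrix.of fun i j => fhat f (n i - n j)) := by
  let e := Fintype.equivFin ι
  have h := hDPP _ (n ∘ e.symm) (hn.comp e.symm.injective)
  have h1 : ∀ ω, ∏ i, ξ ((n ∘ e.symm) i) ω = ∏ i, ξ (n i) ω := fun ω =>
    Equiv.prod_comp e.symm (fun i => ξ (n i) ω)
  simp_rw [h1] at h
  rw [h, ← Matrix.det_submatrix_equiv_self e.symm]
  rfl

lemma kk_dpp_compl (f : AddCircle (1:ℝ) → ℝ) (hf_meas : Measurable f)
    (hf01 : ∀ t, f t ∈ Set.Icc (0:ℝ) 1) (ξ : ℤ → Ω → ℝ)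
    (hξ_meas : ∀ n, Measurable (ξ n))
    (hξ01 : ∀ n ω, ξ n ω = 0 ∨ ξ n ω = 1)
    (hDPP : ∀ (k : ℕ) (n : Fin k → ℤ), Function.Injective n →
      ((∫ ω, ∏ i, ξ (n i) ω ∂P : ℝ) : ℂ) =
        Matrix.det (Matrix.of fun i j => fhat f (n i - n j)))
    {ι : Type*} [Fintype ι] [DecidableEq ι] (n : ι → ℤ) (hn : Function.Injective n) :
    ((∫ ω, ∏ i, (1 - ξ (n i) ω) ∂P : ℝ) : ℂ) =
        Matrix.det (Matrix.of fun i j => fhat (fun t => 1 - f t) (n i - n j)) := by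
  have hM : (Matrix.of fun i j => fhat (fun t => 1 - f t) (n i - n j)) =
      1 + -(Matrix.of fun i j => fhat f (n i - n j)) := by
    ext i j
    simp only [Matrix.of_apply, kk_fhat_compl f hf_meas hf01, Matrix.add_apply, Matrix.neg_apply,
      Matrix.one_apply, sub_eq_zero, hn.eq_iff]
    ring
  rw [hM, kk_det_one_add]
  have h1 : ∀ ω, ∏ i, (1 - ξ (n i) ω) = ∑ s : Finset ι, (-1) ^ s.card * ∏ i ∈ s, ξ (n i) ω := by
    intro ω
    simp_rw [sub_eq_add_neg]
    rw [Finset.prod_one_add, Finset.powerset_univ]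
    refine Finset.sum_congr rfl fun s _ => ?_
    rw [Finset.prod_neg]
  simp_rw [h1]
  rw [integral_finsetSum _ (fun s _ => (kk_integrable_prod P ξ hξ_meas hξ01 s n).const_mul _)]
  push_cast
  refine Finset.sum_congr rfl fun s _ => ?_
  rw [integral_const_mul]
  have h2 := kk_dpp P f ξ hDPP (fun i : s => n i) (hn.comp Subtype.val_injective)
  have h3 : ∀ ω, ∏ i ∈ s, ξ (n i) ω = ∏ i : s, ξ (n i) ω := fun ω =>
    (Finset.prod_coe_sort s (fun i => ξ (n i) ω)).symm
  simp_rw [h3]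
  push_cast
  rw [h2, ← Fintype.card_coe s, ← Matrix.det_neg]
  rfl

lemma kk_moment (f : AddCircle (1:ℝ) → ℝ) (hf_meas : Measurable f)
    (hf01 : ∀ t, f t ∈ Set.Icc (0:ℝ) 1) (η : ℤ → Ω → ℝ)
    (h : ∀ A : Finset ℤ, ((∫ ω, ∏ i : A, η i ω ∂P : ℝ) : ℂ) =
        Matrix.det (Matrix.of fun i j : A => fhat f ((i:ℤ) - j))) (A : Finset ℤ) :
    ∫ ω, ∏ i ∈ A, η i ω ∂P ≤ (∫ t, f t ∂kkμ) ^ A.card := by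
  have h1 := kk_det_le _ (kk_posSemidef f hf_meas hf01 (fun i : A => (i : ℤ))) (∫ t, f t ∂kkμ)
    (by intro i; simp only [Matrix.of_apply, sub_self]; exact kk_fhat_zero f)
  rw [← h A, Complex.ofReal_re, Fintype.card_coe] at h1
  have h3 : ∀ ω, ∏ i ∈ A, η i ω = ∏ i : A, η i ω := fun ω =>
    (Finset.prod_coe_sort A (fun i => η i ω)).symm
  simp_rw [h3]
  exact h1

lemma kk_mgf (η : ℤ → Ω → ℝ) (hη_meas : ∀ n, Measurable (η n))
    (hη01 : ∀ n ω, η n ω = 0 ∨ η n ω = 1) (q : ℝ) (hq : ∀ n, ∫ ω, η n ω ∂P = q)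
    (h : ∀ A : Finset ℤ, ∫ ω, ∏ i ∈ A, η i ω ∂P ≤ q ^ A.card)
    (F : Finset ℤ) (b : ℤ → ℝ) (hb : ∀ n ∈ F, 0 ≤ b n) :
    ∫ ω, Real.exp (∑ n ∈ F, b n * (η n ω - q)) ∂P ≤ Real.exp (∑ n ∈ F, (b n) ^ 2 / 8) := by
  have e1 : ∀ n ω, Real.exp (b n * η n ω) = 1 + (Real.exp (b n) - 1) * η n ω := by
    intro n ω
    rcases hη01 n ω with h | h <;> simp [h]
  have e2 : ∀ n ω, Real.exp (b n * (η n ω - q)) =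
      Real.exp (-(b n * q)) * (1 + (Real.exp (b n) - 1) * η n ω) := by
    intro n ω
    rw [← e1, ← Real.exp_add]; congr 1; ring
  have hintg : ∀ n, Integrable (η n) P := fun n => by
    simpa using kk_integrable_prod P η hη_meas hη01 {n} id
  have hoeff : ∀ n, Real.exp (-(b n * q)) * (1 + (Real.exp (b n) - 1) * q) ≤
      Real.exp ((b n) ^ 2 / 8) := by
    intro n
    have h1 := (ProbabilityTheory.hasSubgaussianMGF_of_mem_Icc (μ := P) (X := η n) (a := 0) (b := 1)
      (hη_meas n).aemeasurable (Eventually.of_forall fun ω => by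
        rcases hη01 n ω with h | h <;> simp [h])).mgf_le (b n)
    simp only [ProbabilityTheory.mgf, hq, e2] at h1
    rw [integral_const_mul, integral_add (integrable_const _) ((hintg n).const_mul _),
      integral_const_mul, hq] at h1
    simp at h1
    refine h1.trans (Real.exp_le_exp.2 (le_of_eq ?_))
    ring
  have e3 : ∀ ω, Real.exp (∑ n ∈ F, b n * (η n ω - q)) = ∑ A ∈ F.powerset,
      ((∏ n ∈ F, Real.exp (-(b n * q))) * ∏ n ∈ A, (Real.exp (b n) - 1)) * ∏ n ∈ A, η n ω := by
    intro ω
    rw [Real.exp_sum]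
    simp_rw [e2]
    rw [Finset.prod_mul_distrib, Finset.prod_one_add, Finset.mul_sum]
    refine Finset.sum_congr rfl fun A _ => ?_
    rw [Finset.prod_mul_distrib, mul_assoc]
  simp_rw [e3]
  rw [integral_finsetSum _ (fun A _ => Integrable.const_mul (f := fun ω => ∏ n ∈ A, η n ω)
    (kk_integrable_prod P η hη_meas hη01 A id) _)]
  calc _ ≤ ∑ A ∈ F.powerset,
      ((∏ n ∈ F, Real.exp (-(b n * q))) * ∏ n ∈ A, (Real.exp (b n) - 1)) * q ^ A.card := by
        refine Finset.sum_le_sum fun A hA => ?_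
        rw [integral_const_mul]
        refine mul_le_mul_of_nonneg_left (h A) (mul_nonneg
          (Finset.prod_nonneg fun _ _ => (Real.exp_pos _).le) (Finset.prod_nonneg fun n hn => ?_))
        have := Real.one_le_exp (hb n (Finset.mem_powerset.1 hA hn))
        linarith
    _ = ∏ n ∈ F, Real.exp (-(b n * q)) * (1 + (Real.exp (b n) - 1) * q) := by
        rw [Finset.prod_mul_distrib, Finset.prod_one_add, Finset.mul_sum]
        refine Finset.sum_congr rfl fun A _ => ?_
        rw [Finset.prod_mul_distrib, mul_assoc, Finset.prod_const]
    _ ≤ ∏ n ∈ F, Real.exp ((b n) ^ 2 / 8) := by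
        refine Finset.prod_le_prod (fun n hn => ?_) (fun n _ => hoeff n)
        have hq0 : 0 ≤ q := by
          rw [← hq n]; exact integral_nonneg fun ω => by
            rcases hη01 n ω with h | h <;> simp [h]
        have := Real.one_le_exp (hb n hn)
        exact mul_nonneg (Real.exp_pos _).le (by nlinarith [mul_nonneg (sub_nonneg.2 this) hq0])
    _ = _ := (Real.exp_sum _ _).symm

lemma kk_subg_pos (ξ : ℤ → Ω → ℝ) (hξ_meas : ∀ n, Measurable (ξ n))
    (hξ01 : ∀ n ω, ξ n ω = 0 ∨ ξ n ω = 1) (σ : ℝ) (hq : ∀ n, ∫ ω, ξ n ω ∂P = σ)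
    (h : ∀ A : Finset ℤ, ∫ ω, ∏ i ∈ A, ξ i ω ∂P ≤ σ ^ A.card)
    (h' : ∀ A : Finset ℤ, ∫ ω, ∏ i ∈ A, (1 - ξ i ω) ∂P ≤ (1 - σ) ^ A.card)
    (F : Finset ℤ) (b : ℤ → ℝ) (hb : ∀ n ∈ F, 0 ≤ b n) :
    ProbabilityTheory.HasSubgaussianMGF (fun ω => ∑ n ∈ F, b n * (ξ n ω - σ))
      (∑ n ∈ F, (b n) ^ 2 / 4).toNNReal P := by
  have hcoe : ((∑ n ∈ F, (b n) ^ 2 / 4).toNNReal : ℝ) = ∑ n ∈ F, (b n) ^ 2 / 4 :=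
    Real.coe_toNNReal _ (Finset.sum_nonneg fun _ _ => by positivity)
  constructor
  · intro t
    refine ProbabilityTheory.integrable_exp_mul_of_mem_Icc (a := -(∑ n ∈ F, |b n| * (1 + |σ|)))
      (b := ∑ n ∈ F, |b n| * (1 + |σ|)) (Finset.measurable_fun_sum _ fun n _ =>
        ((hξ_meas n).sub_const _).const_mul _).aemeasurable (Eventually.of_forall fun ω => ?_)
    rw [Set.mem_Icc, ← abs_le]
    refine (Finset.abs_sum_le_sum_abs _ _).trans (Finset.sum_le_sum fun n _ => ?_)
    rw [abs_mul]
    gcongr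
    refine (abs_sub _ _).trans ?_
    gcongr
    rcases hξ01 n ω with h | h <;> simp [h]
  · intro t
    rw [hcoe]
    simp only [ProbabilityTheory.mgf]
    rcases le_total 0 t with ht | ht
    · have := kk_mgf P ξ hξ_meas hξ01 σ hq h F (fun n => t * b n)
        (fun n hn => mul_nonneg ht (hb n hn))
      convert this using 2
      · ext ω; rw [Finset.mul_sum]; simp only [mul_assoc]
      · rw [Finset.sum_mul, Finset.sum_div]; refine Finset.sum_congr rfl fun n _ => ?_; ring
    · have := kk_mgf P (fun n ω => 1 - ξ n ω) (fun n => (hξ_meas n).const_sub 1)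
        (fun n ω => by rcases hξ01 n ω with h | h <;> simp [h]) (1 - σ)
        (fun n => by
          have hintg : Integrable (ξ n) P := by
            simpa using kk_integrable_prod P ξ hξ_meas hξ01 {n} id
          rw [integral_sub (integrable_const _) hintg, hq]; simp) h' F (fun n => (-t) * b n)
        (fun n hn => mul_nonneg (by linarith) (hb n hn))
      convert this using 2
      · ext ω; rw [Finset.mul_sum]; congr 1; refine Finset.sum_congr rfl fun n _ => ?_; ring
      · rw [Finset.sum_mul, Finset.sum_div]; refine Finset.sum_congr rfl fun n _ => ?_; ring

lemma kk_subg (ξ : ℤ → Ω → ℝ) (hξ_meas : ∀ n, Measurable (ξ n))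
    (hξ01 : ∀ n ω, ξ n ω = 0 ∨ ξ n ω = 1) (σ : ℝ) (hq : ∀ n, ∫ ω, ξ n ω ∂P = σ)
    (h : ∀ A : Finset ℤ, ∫ ω, ∏ i ∈ A, ξ i ω ∂P ≤ σ ^ A.card)
    (h' : ∀ A : Finset ℤ, ∫ ω, ∏ i ∈ A, (1 - ξ i ω) ∂P ≤ (1 - σ) ^ A.card)
    (F : Finset ℤ) (b : ℤ → ℝ) :
    ProbabilityTheory.HasSubgaussianMGF (fun ω => ∑ n ∈ F, b n * (ξ n ω - σ))
      (∑ n ∈ F, (b n) ^ 2 / 2).toNNReal P := by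
  have h1 := kk_subg_pos P ξ hξ_meas hξ01 σ hq h h' (F.filter (fun n => 0 ≤ b n)) b
    (fun n hn => (Finset.mem_filter.1 hn).2)
  have h2 := (kk_subg_pos P ξ hξ_meas hξ01 σ hq h h' (F.filter (fun n => ¬ 0 ≤ b n)) (fun n => - b n)
    (fun n hn => by have := (Finset.mem_filter.1 hn).2; linarith)).neg
  have h3 := h1.add h2
  have e : (fun ω => ∑ n ∈ F with 0 ≤ b n, b n * (ξ n ω - σ) +
      (-fun ω => ∑ n ∈ F with ¬0 ≤ b n, -b n * (ξ n ω - σ)) ω) =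
      fun ω => ∑ n ∈ F, b n * (ξ n ω - σ) := by
    ext ω
    simp only [Pi.neg_apply, neg_mul, Finset.sum_neg_distrib, neg_neg]
    exact Finset.sum_filter_add_sum_filter_not F _ _
  rw [e] at h3
  refine ⟨h3.integrable_exp_mul, fun t => (h3.mgf_le t).trans (Real.exp_le_exp.2 ?_)⟩
  gcongr
  rw [← NNReal.coe_le_coe]
  rw [Real.coe_toNNReal _ (Finset.sum_nonneg fun _ _ => by positivity)]
  push_cast
  rw [Real.coe_toNNReal _ (Finset.sum_nonneg fun _ _ => by positivity),
    Real.coe_toNNReal _ (Finset.sum_nonneg fun _ _ => by positivity)]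
  have e2 := Finset.sum_filter_add_sum_filter_not F (fun n => 0 ≤ b n) (fun n => b n ^ 2 / 4)
  have e3 : ∑ n ∈ F, b n ^ 2 / 2 = 2 * ∑ n ∈ F, b n ^ 2 / 4 := by
    rw [Finset.mul_sum]; refine Finset.sum_congr rfl fun n _ => ?_; ring
  simp only [neg_sq]
  rw [e3, ← e2]
  set x := ∑ n ∈ F with 0 ≤ b n, b n ^ 2 / 4
  set y := ∑ n ∈ F with ¬0 ≤ b n, b n ^ 2 / 4
  have hx : 0 ≤ x := Finset.sum_nonneg fun _ _ => by positivity
  have hy : 0 ≤ y := Finset.sum_nonneg fun _ _ => by positivity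
  nlinarith [Real.sq_sqrt hx, Real.sq_sqrt hy, sq_nonneg (√x - √y)]

lemma kk_moments (X : Ω → ℝ) (hX : Measurable X) (A : ℝ) (hA : 0 < A)
    (h : ProbabilityTheory.HasSubgaussianMGF X (A ^ 2 / 2).toNNReal P) (p : ℝ) (hp : 2 ≤ p) :
    eLpNorm X (ENNReal.ofReal p) P ≤ ENNReal.ofReal (√2 * Real.Gamma (p / 2 + 1) ^ (1 / p) * A) := by
  have hp0 : 0 < p := by linarith
  have hc : ((A ^ 2 / 2).toNNReal : ℝ) = A ^ 2 / 2 := Real.coe_toNNReal _ (by positivity)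
  have hG : 0 < Real.Gamma (p / 2 + 1) := Real.Gamma_pos_of_pos (by linarith)
  have tail : ∀ t ∈ Set.Ioi (0:ℝ), P {ω | t ≤ |X ω|} ≤
      ENNReal.ofReal (2 * Real.exp (-(1 / A ^ 2) * t ^ (2:ℝ))) := by
    intro t ht
    have ht0 : (0:ℝ) ≤ t := le_of_lt ht
    have h1 := h.measure_ge_le ht0
    have h2 := h.neg.measure_ge_le ht0
    have he : -t ^ 2 / (2 * ((A ^ 2 / 2).toNNReal : ℝ)) = -(1 / A ^ 2) * t ^ (2:ℝ) := by
      rw [hc, Real.rpow_two]; field_simp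
    rw [he] at h1 h2
    have hsub : {ω | t ≤ |X ω|} ⊆ {ω | t ≤ X ω} ∪ {ω | t ≤ (-X) ω} := by
      intro ω hω
      simpa [le_abs] using hω
    refine (measure_mono hsub).trans ((measure_union_le _ _).trans ?_)
    rw [two_mul, ENNReal.ofReal_add (Real.exp_pos _).le (Real.exp_pos _).le]
    refine add_le_add ?_ ?_
    · rw [← ofReal_measureReal]; exact ENNReal.ofReal_le_ofReal h1
    · rw [← ofReal_measureReal]; exact ENNReal.ofReal_le_ofReal h2
  have hintg : ∫⁻ ω, ENNReal.ofReal (|X ω| ^ p) ∂P ≤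
      ENNReal.ofReal (2 * Real.Gamma (p / 2 + 1) * A ^ p) := by
    rw [lintegral_rpow_eq_lintegral_meas_le_mul P (Eventually.of_forall fun ω => abs_nonneg _)
      hX.abs.aemeasurable hp0]
    have hb : (0:ℝ) < 1 / A ^ 2 := by positivity
    calc _ ≤ ENNReal.ofReal p * ∫⁻ t in Set.Ioi (0:ℝ),
          ENNReal.ofReal (2 * (t ^ (p - 1) * Real.exp (-(1 / A ^ 2) * t ^ (2:ℝ)))) := by
            refine mul_le_mul' le_rfl ?_
            refine setLIntegral_mono' (measurableSet_Ioi (a := (0:ℝ))) fun t ht => ?_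
            refine (mul_le_mul' (tail t ht) le_rfl).trans ?_
            rw [← ENNReal.ofReal_mul (by positivity)]
            exact ENNReal.ofReal_le_ofReal (le_of_eq (by ring))
      _ = ENNReal.ofReal p * ENNReal.ofReal (∫ t in Set.Ioi (0:ℝ),
          (2 * (t ^ (p - 1) * Real.exp (-(1 / A ^ 2) * t ^ (2:ℝ))))) := by
            rw [ofReal_integral_eq_lintegral_ofReal]
            · refine Integrable.const_mul ?_ _
              exact integrableOn_rpow_mul_exp_neg_mul_rpow (by linarith) (by norm_num) hb
            · refine (ae_restrict_iff' (measurableSet_Ioi (a := (0:ℝ)))).2 (Eventually.of_forall fun t ht => ?_)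
              have : (0:ℝ) ≤ t := le_of_lt ht
              positivity
      _ = _ := by
            rw [← ENNReal.ofReal_mul hp0.le, integral_const_mul,
              _root_.integral_rpow_mul_exp_neg_mul_rpow (by norm_num) (by linarith) hb]
            congr 1
            rw [Real.Gamma_add_one (by positivity)]
            have : (1 / A ^ 2) ^ (-(p - 1 + 1) / 2) = A ^ p := by
              rw [one_div, ← Real.rpow_natCast, ← Real.rpow_neg hA.le, ← Real.rpow_mul hA.le]
              congr 1; push_cast; ring
            rw [this, sub_add_cancel]; ring
  have hpne : ENNReal.ofReal p ≠ 0 := by simpa using hp0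
  rw [eLpNorm_eq_lintegral_rpow_enorm_toReal hpne ENNReal.ofReal_ne_top, ENNReal.toReal_ofReal hp0.le]
  have e1 : ∀ ω, ‖X ω‖ₑ ^ p = ENNReal.ofReal (|X ω| ^ p) := by
    intro ω
    rw [← ENNReal.ofReal_rpow_of_nonneg (abs_nonneg _) hp0.le, Real.enorm_eq_ofReal_abs]
  simp_rw [e1]
  refine (ENNReal.rpow_le_rpow hintg (by positivity)).trans ?_
  rw [ENNReal.ofReal_rpow_of_nonneg (by positivity) (by positivity)]
  refine ENNReal.ofReal_le_ofReal ?_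
  rw [Real.mul_rpow (by positivity) (by positivity), Real.mul_rpow (by positivity) (by positivity),
    ← Real.rpow_mul hA.le, mul_one_div_cancel hp0.ne', Real.rpow_one]
  gcongr
  rw [Real.sqrt_eq_rpow]
  exact Real.rpow_le_rpow_of_exponent_le (by norm_num) (one_div_le_one_div_of_le (by norm_num) hp)

lemma kk_real (ξ : ℤ → Ω → ℝ) (hξ_meas : ∀ n, Measurable (ξ n))
    (hξ01 : ∀ n ω, ξ n ω = 0 ∨ ξ n ω = 1) (σ : ℝ) (hq : ∀ n, ∫ ω, ξ n ω ∂P = σ)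
    (h : ∀ A : Finset ℤ, ∫ ω, ∏ i ∈ A, ξ i ω ∂P ≤ σ ^ A.card)
    (h' : ∀ A : Finset ℤ, ∫ ω, ∏ i ∈ A, (1 - ξ i ω) ∂P ≤ (1 - σ) ^ A.card)
    (F : Finset ℤ) (b : ℤ → ℝ) (p : ℝ) (hp : 2 ≤ p) :
    eLpNorm (fun ω => ∑ n ∈ F, b n * (ξ n ω - σ)) (ENNReal.ofReal p) P ≤
      ENNReal.ofReal (√2 * Real.Gamma (p / 2 + 1) ^ (1 / p) * √(∑ n ∈ F, b n ^ 2)) := by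
  have hs := kk_subg P ξ hξ_meas hξ01 σ hq h h' F b
  rcases (Finset.sum_nonneg (s := F) (f := fun n => b n ^ 2) fun n _ => sq_nonneg _).eq_or_lt with h0 | h0
  · have hz := (Finset.sum_eq_zero_iff_of_nonneg (fun n _ => sq_nonneg (b n))).1 h0.symm
    have : (fun ω => ∑ n ∈ F, b n * (ξ n ω - σ)) = 0 := by
      ext ω
      refine Finset.sum_eq_zero fun n hn => ?_
      have := hz n hn
      simp only [ne_eq, OfNat.ofNat_ne_zero, not_false_eq_true, pow_eq_zero_iff] at this
      simp [this]
    rw [this]; simp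
  · refine kk_moments P _ (Finset.measurable_fun_sum _ fun n _ =>
        ((hξ_meas n).sub_const _).const_mul _) _ (Real.sqrt_pos.2 h0) ?_ p hp
    rw [Real.sq_sqrt h0.le, Finset.sum_div]
    exact hs

end kkprob

lemma kk_abs_f {f : AddCircle (1:ℝ) → ℝ} (hf01 : ∀ t, f t ∈ Set.Icc (0:ℝ) 1) (t) :
    ‖(f t : ℂ)‖ ≤ 1 := by
  rw [Complex.norm_real, Real.norm_eq_abs]
  exact abs_le.2 ⟨by linarith [(hf01 t).1], (hf01 t).2⟩

lemma kk_term (f : AddCircle (1:ℝ) → ℝ) (hf_meas : Measurable f)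
    (hf01 : ∀ t, f t ∈ Set.Icc (0:ℝ) 1) (k : ℤ) :
    Integrable (fun z : AddCircle (1:ℝ) × AddCircle (1:ℝ) =>
      (((f z.1 - f z.2) ^ 2 / 2 : ℝ) : ℂ) * (fourier k z.1 * fourier (-k) z.2)) (kkμ.prod kkμ) ∧
    ∫ z : AddCircle (1:ℝ) × AddCircle (1:ℝ),
      (((f z.1 - f z.2) ^ 2 / 2 : ℝ) : ℂ) * (fourier k z.1 * fourier (-k) z.2) ∂(kkμ.prod kkμ) =
      (if k = 0 then ((∫ t, f t ^ 2 ∂kkμ : ℝ) : ℂ) else 0) - fhat f k * fhat f (-k) := by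
  have hb0 : ∀ j, Integrable (fun t => (fourier j t : ℂ)) kkμ := fun j =>
    kk_integrable _ (kk_meas_fourier _) 1 (fun t => (kk_norm_fourier _ _).le)
  have hb1 : ∀ j, Integrable (fun t => (fourier j t * (f t : ℂ))) kkμ := fun j =>
    kk_integrable _ ((kk_meas_fourier _).mul (by fun_prop)) 1 (fun t => by
      rw [norm_mul, kk_norm_fourier, one_mul]; exact kk_abs_f hf01 t)
  have hb2 : ∀ j, Integrable (fun t => (fourier j t * (f t : ℂ) ^ 2)) kkμ := fun j =>
    kk_integrable _ ((kk_meas_fourier _).mul (by fun_prop)) 1 (fun t => by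
      rw [norm_mul, kk_norm_fourier, one_mul, norm_pow]
      exact pow_le_one₀ (norm_nonneg _) (kk_abs_f hf01 t))
  have e : (fun z : AddCircle (1:ℝ) × AddCircle (1:ℝ) =>
      (((f z.1 - f z.2) ^ 2 / 2 : ℝ) : ℂ) * (fourier k z.1 * fourier (-k) z.2)) =
      fun z => (1 / 2 : ℂ) * ((fourier k z.1 * (f z.1 : ℂ) ^ 2) * fourier (-k) z.2) +
        (1 / 2 : ℂ) * (fourier k z.1 * (fourier (-k) z.2 * (f z.2 : ℂ) ^ 2)) -
        (fourier k z.1 * (f z.1 : ℂ)) * (fourier (-k) z.2 * (f z.2 : ℂ)) := by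
    ext z; push_cast; ring
  have i1 := ((hb2 k).mul_prod (hb0 (-k))).const_mul (1 / 2 : ℂ)
  have i2 := ((hb0 k).mul_prod (hb2 (-k))).const_mul (1 / 2 : ℂ)
  have i3 := (hb1 k).mul_prod (hb1 (-k))
  rw [e]
  refine ⟨(i1.add i2).sub i3, ?_⟩
  have j1 := integral_sub (i1.add i2) i3
  have j2 := integral_add i1 i2
  simp only [Pi.add_apply] at j1
  rw [j1, j2, integral_const_mul, integral_const_mul]
  rw [integral_prod_mul (μ := kkμ) (ν := kkμ) (fun t => fourier k t * (f t : ℂ) ^ 2)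
      (fun t => (fourier (-k) t : ℂ)),
    integral_prod_mul (μ := kkμ) (ν := kkμ) (fun t => (fourier k t : ℂ))
      (fun t => fourier (-k) t * (f t : ℂ) ^ 2),
    integral_prod_mul (μ := kkμ) (ν := kkμ) (fun t => fourier k t * (f t : ℂ))
      (fun t => fourier (-k) t * (f t : ℂ)), kk_int_fourier, kk_int_fourier, kk_fhat, kk_fhat]
  simp only [neg_eq_zero, neg_neg]
  split_ifs with hk
  · subst hk
    have : ∫ t, (f t : ℂ) ^ 2 ∂kkμ = ((∫ t, f t ^ 2 ∂kkμ : ℝ) : ℂ) := by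
      rw [← integral_complex_ofReal]; simp
    simp only [neg_zero, fourier_zero, one_mul, mul_one, this]
    ring
  · ring

lemma kk_quad_nonneg (f : AddCircle (1:ℝ) → ℝ) (hf_meas : Measurable f)
    (hf01 : ∀ t, f t ∈ Set.Icc (0:ℝ) 1) (F : Finset ℤ) (a : ℤ → ℂ) :
    0 ≤ (∑ n ∈ F, ∑ m ∈ F, (a n * star (a m)) *
      ((if n - m = 0 then ((∫ t, f t ^ 2 ∂kkμ : ℝ) : ℂ) else 0) -
        fhat f (n - m) * fhat f (-(n - m)))).re := by
  have key : (∑ n ∈ F, ∑ m ∈ F, (a n * star (a m)) *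
      ((if n - m = 0 then ((∫ t, f t ^ 2 ∂kkμ : ℝ) : ℂ) else 0) -
        fhat f (n - m) * fhat f (-(n - m)))) =
      ((∫ z : AddCircle (1:ℝ) × AddCircle (1:ℝ), (f z.1 - f z.2) ^ 2 / 2 *
        ‖∑ n ∈ F, a n * (fourier n z.1 * fourier (-n) z.2)‖ ^ 2 ∂(kkμ.prod kkμ) : ℝ) : ℂ) := by
    have hi := fun n m => ((kk_term f hf_meas hf01 (n - m)).1).const_mul (a n * star (a m))
    have ht : ∀ n m, (a n * star (a m)) *
      ((if n - m = 0 then ((∫ t, f t ^ 2 ∂kkμ : ℝ) : ℂ) else 0) -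
        fhat f (n - m) * fhat f (-(n - m))) = ∫ z : AddCircle (1:ℝ) × AddCircle (1:ℝ),
          (a n * star (a m)) * ((((f z.1 - f z.2) ^ 2 / 2 : ℝ) : ℂ) *
            (fourier (n - m) z.1 * fourier (-(n - m)) z.2)) ∂(kkμ.prod kkμ) := fun n m => by
      rw [integral_const_mul, (kk_term f hf_meas hf01 (n - m)).2]
    rw [Finset.sum_congr rfl fun n _ => Finset.sum_congr rfl fun m _ => ht n m]
    rw [← integral_complex_ofReal]
    rw [Finset.sum_congr rfl (fun n _ => (integral_finsetSum _ (fun m _ => hi n m)).symm),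
      ← integral_finsetSum _ (fun n _ => integrable_finsetSum _ (fun m _ => hi n m))]
    congr 1; ext z
    rw [Complex.ofReal_mul, Complex.ofReal_pow, ← Complex.mul_conj', map_sum, Finset.sum_mul_sum,
      Finset.mul_sum]
    refine Finset.sum_congr rfl fun n _ => ?_
    rw [Finset.mul_sum]
    refine Finset.sum_congr rfl fun m _ => ?_
    rw [map_mul, map_mul, ← fourier_neg, ← fourier_neg, neg_sub, neg_neg, sub_eq_add_neg n m,
      sub_eq_add_neg m n, fourier_add, fourier_add]
    simp only [starRingEnd_apply]
    ring
  rw [key, Complex.ofReal_re]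
  exact integral_nonneg fun z => by positivity

section kkvar
variable {Ω : Type*} [MeasurableSpace Ω] (P : Measure Ω) [IsProbabilityMeasure P]

lemma kk_mean (f : AddCircle (1:ℝ) → ℝ)
    (σ : ℝ) (hσ : σ = ∫ t, f t ∂kkμ) (ξ : ℤ → Ω → ℝ)
    (hDPP : ∀ (k : ℕ) (n : Fin k → ℤ), Function.Injective n →
      ((∫ ω, ∏ i, ξ (n i) ω ∂P : ℝ) : ℂ) =
        Matrix.det (Matrix.of fun i j => fhat f (n i - n j))) (n : ℤ) :
    ∫ ω, ξ n ω ∂P = σ := by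
  have h := hDPP 1 (fun _ => n) (Function.injective_of_subsingleton _)
  simp [kk_fhat_zero] at h
  rw [hσ]; exact_mod_cast h

lemma kk_cov (f : AddCircle (1:ℝ) → ℝ)
    (σ : ℝ) (hσ : σ = ∫ t, f t ∂kkμ)
    (ξ : ℤ → Ω → ℝ) (hξ_meas : ∀ n, Measurable (ξ n))
    (hξ01 : ∀ n ω, ξ n ω = 0 ∨ ξ n ω = 1)
    (hDPP : ∀ (k : ℕ) (n : Fin k → ℤ), Function.Injective n →
      ((∫ ω, ∏ i, ξ (n i) ω ∂P : ℝ) : ℂ) =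
        Matrix.det (Matrix.of fun i j => fhat f (n i - n j))) (n m : ℤ) :
    ((∫ ω, (ξ n ω - σ) * (ξ m ω - σ) ∂P : ℝ) : ℂ) =
      (if n - m = 0 then (σ : ℂ) else 0) - fhat f (n - m) * fhat f (-(n - m)) := by
  have hmean := kk_mean P f σ hσ ξ hDPP
  have hintg : ∀ n, Integrable (ξ n) P := fun n => by
    simpa using kk_integrable_prod P ξ hξ_meas hξ01 {n} id
  have hf0 : fhat f 0 = σ := by rw [kk_fhat_zero, hσ]
  have hint2 : Integrable (fun ω => ξ n ω * ξ m ω) P := by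
    simpa using kk_integrable_prod P ξ hξ_meas hξ01 (Finset.univ : Finset (Fin 2)) ![n, m]
  have e : ∫ ω, (ξ n ω - σ) * (ξ m ω - σ) ∂P = ∫ ω, ξ n ω * ξ m ω ∂P - σ ^ 2 := by
    have e1 : ∀ ω, (ξ n ω - σ) * (ξ m ω - σ) = ξ n ω * ξ m ω - σ * ξ n ω - σ * ξ m ω + σ ^ 2 := by
      intro ω; ring
    simp_rw [e1]
    have i1 := (hintg n).const_mul σ
    have i2 := (hintg m).const_mul σ
    have i3 : Integrable (fun ω => ξ n ω * ξ m ω - σ * ξ n ω) P := hint2.sub i1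
    have i4 : Integrable (fun ω => ξ n ω * ξ m ω - σ * ξ n ω - σ * ξ m ω) P := i3.sub i2
    rw [integral_add i4 (integrable_const _), integral_sub i3 i2,
      integral_sub hint2 i1, integral_const_mul, integral_const_mul, hmean, hmean]
    simp; ring
  rw [e]
  split_ifs with h
  · obtain rfl : n = m := by omega
    have : ∀ ω, ξ n ω * ξ n ω = ξ n ω := fun ω => by rcases hξ01 n ω with h | h <;> simp [h]
    simp_rw [this]
    rw [hmean, sub_self, neg_zero, hf0]; push_cast; ring
  · have hd := hDPP 2 ![n, m] (by
      intro i j hij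
      fin_cases i <;> fin_cases j <;> simp_all <;> omega)
    simp [Matrix.det_fin_two, hf0] at hd
    rw [Complex.ofReal_sub, hd, neg_sub]; push_cast; ring

lemma kk_var (f : AddCircle (1:ℝ) → ℝ) (hf_meas : Measurable f)
    (hf01 : ∀ t, f t ∈ Set.Icc (0:ℝ) 1)
    (σ : ℝ) (hσ : σ = ∫ t, f t ∂kkμ)
    (ξ : ℤ → Ω → ℝ) (hξ_meas : ∀ n, Measurable (ξ n))
    (hξ01 : ∀ n ω, ξ n ω = 0 ∨ ξ n ω = 1)
    (hDPP : ∀ (k : ℕ) (n : Fin k → ℤ), Function.Injective n →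
      ((∫ ω, ∏ i, ξ (n i) ω ∂P : ℝ) : ℂ) =
        Matrix.det (Matrix.of fun i j => fhat f (n i - n j))) (F : Finset ℤ) (a : ℤ → ℂ) :
    (∫ t, f t * (1 - f t) ∂kkμ) * ∑ n ∈ F, ‖a n‖ ^ 2 ≤
      ∫ ω, ‖∑ n ∈ F, a n * ((ξ n ω : ℂ) - (σ:ℂ))‖ ^ 2 ∂P := by
  have hcov := kk_cov P f σ hσ ξ hξ_meas hξ01 hDPP
  have hi : ∀ n m, Integrable (fun ω => (ξ n ω - σ) * (ξ m ω - σ)) P := by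
    intro n m
    refine Integrable.of_bound (((hξ_meas n).sub_const _).mul
      ((hξ_meas m).sub_const _)).aestronglyMeasurable ((1 + |σ|) * (1 + |σ|))
      (Eventually.of_forall fun ω => ?_)
    have hb : ∀ n, |ξ n ω - σ| ≤ 1 + |σ| := fun n => by
      refine (abs_sub _ _).trans ?_
      gcongr
      rcases hξ01 n ω with h | h <;> simp [h]
    rw [norm_mul]
    exact mul_le_mul (hb n) (hb m) (abs_nonneg _) (by positivity)
  have key : ((∫ ω, ‖∑ n ∈ F, a n * ((ξ n ω : ℂ) - (σ:ℂ))‖ ^ 2 ∂P : ℝ) : ℂ) =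
      ∑ n ∈ F, ∑ m ∈ F, (a n * star (a m)) * ((if n - m = 0 then (σ : ℂ) else 0) -
        fhat f (n - m) * fhat f (-(n - m))) := by
    simp_rw [← hcov, ← integral_complex_ofReal, ← integral_const_mul]
    have hi' : ∀ n m, Integrable (fun ω => (a n * star (a m)) *
        (((ξ n ω - σ) * (ξ m ω - σ) : ℝ) : ℂ)) P := fun n m => (hi n m).ofReal.const_mul _
    rw [Finset.sum_congr rfl (fun n _ => (integral_finsetSum _ (fun m _ => hi' n m)).symm),
      ← integral_finsetSum _ (fun n _ => integrable_finsetSum _ (fun m _ => hi' n m))]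
    congr 1; ext ω
    rw [Complex.ofReal_pow, ← Complex.mul_conj', map_sum, Finset.sum_mul_sum]
    refine Finset.sum_congr rfl fun n _ => Finset.sum_congr rfl fun m _ => ?_
    rw [map_mul, map_sub, Complex.conj_ofReal, Complex.conj_ofReal]
    push_cast
    simp only [starRingEnd_apply]
    ring
  have hif : Integrable f kkμ := Integrable.of_bound hf_meas.aestronglyMeasurable 1
    (Eventually.of_forall fun t => by simpa using kk_abs_f hf01 t)
  have hif2 : Integrable (fun t => f t ^ 2) kkμ :=
    Integrable.of_bound (hf_meas.pow_const 2).aestronglyMeasurable 1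
    (Eventually.of_forall fun t => by
      rw [norm_pow]
      exact pow_le_one₀ (norm_nonneg _) (by simpa using kk_abs_f hf01 t))
  have hv : ∫ t, f t * (1 - f t) ∂kkμ = σ - ∫ t, f t ^ 2 ∂kkμ := by
    rw [hσ, ← integral_sub hif hif2]; congr 1; ext t; ring
  have hq := kk_quad_nonneg f hf_meas hf01 F a
  have hdiff : (∑ n ∈ F, ∑ m ∈ F, (a n * star (a m)) * ((if n - m = 0 then (σ : ℂ) else 0) -
        fhat f (n - m) * fhat f (-(n - m)))) =
      (∑ n ∈ F, ∑ m ∈ F, (a n * star (a m)) *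
      ((if n - m = 0 then ((∫ t, f t ^ 2 ∂kkμ : ℝ) : ℂ) else 0) -
        fhat f (n - m) * fhat f (-(n - m)))) +
      (((∫ t, f t * (1 - f t) ∂kkμ) * ∑ n ∈ F, ‖a n‖ ^ 2 : ℝ) : ℂ) := by
    rw [← sub_eq_iff_eq_add', ← Finset.sum_sub_distrib, hv]
    push_cast
    rw [Finset.mul_sum]
    refine Finset.sum_congr rfl fun n hn => ?_
    rw [← Finset.sum_sub_distrib, Finset.sum_eq_single n]
    · rw [sub_self, if_pos rfl, if_pos rfl, ← Complex.mul_conj']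
      simp only [starRingEnd_apply]; ring
    · intro m _ hm
      have : n - m ≠ 0 := by omega
      simp [this]
    · intro h; exact absurd hn h
  have h1 := congrArg Complex.re (key.trans hdiff)
  rw [Complex.add_re, Complex.ofReal_re, Complex.ofReal_re] at h1
  linarith

end kkvar

/-- Khintchine–Kahane inequality: for p ∈ [2,∞),
‖S‖_{L²} ≤ ‖S‖_{L^p} ≤ C_f(p) ‖S‖_{L²} with
C_f(p) = 2√2 Γ(p/2+1)^{1/p} / √(∫ f(1−f) dm). -/
theorem stmt_15
    (f : AddCircle (1:ℝ) → ℝ) (hf_meas : Measurable f)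
    (hf01 : ∀ t, f t ∈ Set.Icc (0:ℝ) 1)
    (σ : ℝ) (hσ : σ = ∫ t, f t ∂AddCircle.haarAddCircle)
    (hσ0 : 0 < σ) (hσ1 : σ < 1)
    {Ω : Type*} [MeasurableSpace Ω] (P : Measure Ω) [IsProbabilityMeasure P]
    (ξ : ℤ → Ω → ℝ) (hξ_meas : ∀ n, Measurable (ξ n))
    (hξ01 : ∀ n ω, ξ n ω = 0 ∨ ξ n ω = 1)
    (hDPP : ∀ (k : ℕ) (n : Fin k → ℤ), Function.Injective n →
      ((∫ ω, ∏ i, ξ (n i) ω ∂P : ℝ) : ℂ) =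
        Matrix.det (Matrix.of fun i j => fhat f (n i - n j)))
    (hind : 0 < ∫ t, f t * (1 - f t) ∂AddCircle.haarAddCircle) :
    ∀ p : ℝ, 2 ≤ p → ∀ a : ℤ →₀ ℂ,
      eLpNorm (fun ω => ∑ n ∈ a.support, a n * ((ξ n ω : ℂ) - (σ:ℂ))) 2 P ≤
        eLpNorm (fun ω => ∑ n ∈ a.support, a n * ((ξ n ω : ℂ) - (σ:ℂ)))
          (ENNReal.ofReal p) P ∧
      eLpNorm (fun ω => ∑ n ∈ a.support, a n * ((ξ n ω : ℂ) - (σ:ℂ)))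
          (ENNReal.ofReal p) P ≤
        ENNReal.ofReal (2 * Real.sqrt 2 * (Real.Gamma (p/2 + 1)) ^ (1/p) /
            Real.sqrt (∫ t, f t * (1 - f t) ∂AddCircle.haarAddCircle)) *
          eLpNorm (fun ω => ∑ n ∈ a.support, a n * ((ξ n ω : ℂ) - (σ:ℂ))) 2 P := by
  intro p hp a
  set F := a.support with hF
  have hSm : Measurable (fun ω => ∑ n ∈ F, a n * ((ξ n ω : ℂ) - (σ:ℂ))) :=
    Finset.measurable_fun_sum _ fun n _ =>
      (((Complex.measurable_ofReal.comp (hξ_meas n)).sub_const _).const_mul _)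
  have h2p : (2 : ℝ≥0∞) ≤ ENNReal.ofReal p := by
    rw [show (2 : ℝ≥0∞) = ENNReal.ofReal 2 by simp]
    exact ENNReal.ofReal_le_ofReal hp
  refine ⟨eLpNorm_le_eLpNorm_of_exponent_le h2p hSm.aestronglyMeasurable, ?_⟩
  have hp0 : 0 < p := by linarith
  have hG : 0 < Real.Gamma (p / 2 + 1) := Real.Gamma_pos_of_pos (by linarith)
  set G := Real.Gamma (p / 2 + 1) ^ (1 / p) with hGdef
  have hG0 : 0 < G := Real.rpow_pos_of_pos hG _
  set v := ∫ t, f t * (1 - f t) ∂AddCircle.haarAddCircle with hv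
  set N := ∑ n ∈ F, ‖a n‖ ^ 2 with hN
  have hN0 : 0 ≤ N := Finset.sum_nonneg fun _ _ => by positivity
  have hmean := kk_mean P f σ hσ ξ hDPP
  have hf01' : ∀ t, (fun t => 1 - f t) t ∈ Set.Icc (0:ℝ) 1 := fun t =>
    ⟨by have := (hf01 t).2; simp only; linarith, by have := (hf01 t).1; simp only; linarith⟩
  have hif : Integrable f kkμ := Integrable.of_bound hf_meas.aestronglyMeasurable 1
    (Eventually.of_forall fun t => by simpa using kk_abs_f hf01 t)
  have hσ' : ∫ t, (fun t => 1 - f t) t ∂kkμ = 1 - σ := by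
    rw [hσ, integral_sub (integrable_const _) hif]; simp
  have hA : ∀ A : Finset ℤ, ∫ ω, ∏ i ∈ A, ξ i ω ∂P ≤ σ ^ A.card := by
    intro A
    rw [hσ]
    exact kk_moment P f hf_meas hf01 ξ
      (fun A => kk_dpp P f ξ hDPP (fun i : A => (i:ℤ)) Subtype.val_injective) A
  have hA' : ∀ A : Finset ℤ, ∫ ω, ∏ i ∈ A, (1 - ξ i ω) ∂P ≤ (1 - σ) ^ A.card := by
    intro A
    rw [← hσ']
    exact kk_moment P (fun t => 1 - f t) (hf_meas.const_sub 1) hf01' (fun n ω => 1 - ξ n ω)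
      (fun A => kk_dpp_compl P f hf_meas hf01 ξ hξ_meas hξ01 hDPP (fun i : A => (i:ℤ))
        Subtype.val_injective) A
  have hre := kk_real P ξ hξ_meas hξ01 σ hmean hA hA' F (fun n => (a n).re) p hp
  have him := kk_real P ξ hξ_meas hξ01 σ hmean hA hA' F (fun n => (a n).im) p hp
  have hsplit : (fun ω => ∑ n ∈ F, a n * ((ξ n ω : ℂ) - (σ:ℂ))) =
      (fun ω => ((∑ n ∈ F, (a n).re * (ξ n ω - σ) : ℝ) : ℂ)) +
      (fun ω => ((∑ n ∈ F, (a n).im * (ξ n ω - σ) : ℝ) : ℂ) * Complex.I) := by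
    ext ω
    simp only [Pi.add_apply]
    push_cast
    rw [Finset.sum_mul, ← Finset.sum_add_distrib]
    refine Finset.sum_congr rfl fun n _ => ?_
    conv_lhs => rw [← Complex.re_add_im (a n)]
    ring
  have hrm : ∀ b : ℤ → ℝ, Measurable (fun ω => ((∑ n ∈ F, b n * (ξ n ω - σ) : ℝ) : ℂ)) := fun b =>
    Complex.measurable_ofReal.comp (Finset.measurable_fun_sum _ fun n _ =>
        ((hξ_meas n).sub_const _).const_mul _)
  have hup : eLpNorm (fun ω => ∑ n ∈ F, a n * ((ξ n ω : ℂ) - (σ:ℂ))) (ENNReal.ofReal p) P ≤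
      ENNReal.ofReal (2 * √2 * G * √N) := by
    rw [hsplit]
    refine (eLpNorm_add_le (hrm _).aestronglyMeasurable
      ((hrm _).mul_const _).aestronglyMeasurable (le_trans (by norm_num) h2p)).trans ?_
    have n1 : eLpNorm (fun ω => ((∑ n ∈ F, (a n).re * (ξ n ω - σ) : ℝ) : ℂ)) (ENNReal.ofReal p) P
        = eLpNorm (fun ω => ∑ n ∈ F, (a n).re * (ξ n ω - σ)) (ENNReal.ofReal p) P :=
      eLpNorm_congr_norm_ae (Eventually.of_forall fun ω => Complex.norm_real _)
    have n2 : eLpNorm (fun ω => ((∑ n ∈ F, (a n).im * (ξ n ω - σ) : ℝ) : ℂ) * Complex.I)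
        (ENNReal.ofReal p) P
        = eLpNorm (fun ω => ∑ n ∈ F, (a n).im * (ξ n ω - σ)) (ENNReal.ofReal p) P :=
      eLpNorm_congr_norm_ae (Eventually.of_forall fun ω => by
        rw [norm_mul, Complex.norm_I, mul_one, Complex.norm_real])
    rw [n1, n2]
    refine (add_le_add hre him).trans ?_
    rw [← ENNReal.ofReal_add (by positivity) (by positivity)]
    refine ENNReal.ofReal_le_ofReal ?_
    have s1 : √(∑ n ∈ F, (a n).re ^ 2) ≤ √N := Real.sqrt_le_sqrt
      (Finset.sum_le_sum fun n _ => by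
        rw [Complex.sq_norm, Complex.normSq_apply]; nlinarith [sq_nonneg (a n).im])
    have s2 : √(∑ n ∈ F, (a n).im ^ 2) ≤ √N := Real.sqrt_le_sqrt
      (Finset.sum_le_sum fun n _ => by
        rw [Complex.sq_norm, Complex.normSq_apply]; nlinarith [sq_nonneg (a n).re])
    calc _ ≤ √2 * G * √N + √2 * G * √N := by gcongr
      _ = _ := by ring
  have hlow : ENNReal.ofReal (√v * √N) ≤
      eLpNorm (fun ω => ∑ n ∈ F, a n * ((ξ n ω : ℂ) - (σ:ℂ))) 2 P := by
    have hvar := kk_var P f hf_meas hf01 σ hσ ξ hξ_meas hξ01 hDPP F a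
    have hml : MemLp (fun ω => ∑ n ∈ F, a n * ((ξ n ω : ℂ) - (σ:ℂ))) 2 P := by
      refine MemLp.of_bound hSm.aestronglyMeasurable (∑ n ∈ F, ‖a n‖ * (1 + |σ|))
        (Eventually.of_forall fun ω => ?_)
      refine (norm_sum_le _ _).trans (Finset.sum_le_sum fun n _ => ?_)
      rw [norm_mul]
      gcongr
      refine (norm_sub_le _ _).trans ?_
      rw [Complex.norm_real, Complex.norm_real, Real.norm_eq_abs, Real.norm_eq_abs]
      gcongr
      rcases hξ01 n ω with h | h <;> simp [h]
    rw [hml.eLpNorm_eq_integral_rpow_norm (by norm_num) (by norm_num)]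
    refine ENNReal.ofReal_le_ofReal ?_
    rw [← Real.sqrt_mul hind.le]
    simp only [ENNReal.toReal_ofNat, Real.rpow_two]
    rw [← one_div, ← Real.sqrt_eq_rpow]
    exact Real.sqrt_le_sqrt hvar
  refine hup.trans (le_trans (le_of_eq ?_) (mul_le_mul' le_rfl hlow))
  rw [← ENNReal.ofReal_mul (by positivity)]
  congr 1
  have : √v ≠ 0 := (Real.sqrt_pos.2 hind).ne'
  field_simp
end
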